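/- For every b ∈ ℚ∖ℤ, the function t ↦ F(t,b) is algebraic: there exists a nonzero polynomial P ∈ ℝ[X,Y] such that P(t, F(t,b)) = 0 for all t ∈ (0,1/4). -/

import Mathlib

open Complex Real Set

noncomputable section

/-- A lattice point `(x,y)` viewed as the complex number `x + iy`. -/
def ptC (p : ℤ × ℤ) : ℂ := (p.1 : ℂ) + (p.2 : ℂ) * Complex.I

/-- A diagonal step on `ℤ²`. -/
def IsDiagStep (a b : ℤ × ℤ) : Prop :=
  b - a = (1, 1) ∨ b - a = (1, -1) ∨ b - a = (-1, -1) ∨ b - a = (-1, 1)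

/-- A rectilinear step on `ℤ²`. -/
def IsRectStep (a b : ℤ × ℤ) : Prop :=
  b - a = (1, 0) ∨ b - a = (-1, 0) ∨ b - a = (0, 1) ∨ b - a = (0, -1)

/-- `w` encodes a simple diagonal walk `(w₀, …, w_n)` as a list of length `n+1`. -/
def IsWalkList (w : List (ℤ × ℤ)) : Prop := w ≠ [] ∧ w.Chain' IsDiagStep

/-- Winding angle of the walk `w` around the origin up to time `i`. -/
def windTo (w : List (ℤ × ℤ)) (i : ℕ) : ℝ :=
  ∑ j ∈ Finset.range i, (ptC (w.getD (j + 1) 0) / ptC (w.getD j 0)).arg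

/-- The full winding angle of the walk `w` around the origin. -/
def wind (w : List (ℤ × ℤ)) : ℝ := windTo w (w.length - 1)

/-- The condition on walks counted by `W^{(α,I)}_{l,p}`: a simple diagonal walk on
`ℤ² ∖ {0}` from `(p,0)` to a point on one of the axes at distance `l` from the origin,
with full winding angle `α` and intermediate winding angles in `I`. -/
def WCond (l p : ℕ) (α : ℝ) (I : Set ℝ) (w : List (ℤ × ℤ)) : Prop :=
  IsWalkList w ∧ (∀ x ∈ w, x ≠ (0, 0)) ∧ w.head? = some ((p : ℤ), 0) ∧
    (w.getLast? = some ((l : ℤ), 0) ∨ w.getLast? = some (-(l : ℤ), 0) ∨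
      w.getLast? = some (0, (l : ℤ)) ∨ w.getLast? = some (0, -(l : ℤ))) ∧
    wind w = α ∧ (∀ i, 1 ≤ i → i ≤ w.length - 2 → windTo w i ∈ I)

/-- The generating function `W^{(α,I)}_{l,p}(t)`. -/
def Wgen (t : ℝ) (l p : ℕ) (α : ℝ) (I : Set ℝ) : ℝ :=
  ∑' w : {w : List (ℤ × ℤ) // WCond l p α I w}, t ^ (w.val.length - 1)

/-- The complete elliptic integral of the first kind `K(k)`. -/
def Kell (k : ℝ) : ℝ := ∫ y in (0:ℝ)..1, 1 / Real.sqrt ((1 - y ^ 2) * (1 - k ^ 2 * y ^ 2))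

/-- The complete elliptic integral of the second kind `E(k)`. -/
def Eell (k : ℝ) : ℝ := ∫ y in (0:ℝ)..1, Real.sqrt (1 - k ^ 2 * y ^ 2) / Real.sqrt (1 - y ^ 2)

/-- The complementary modulus `k' = √(1-k²)`. -/
def kComp (k : ℝ) : ℝ := Real.sqrt (1 - k ^ 2)

/-- The elliptic nome `q_k = exp(-π K(k')/K(k))`. -/
def qNome (k : ℝ) : ℝ := Real.exp (-π * Kell (kComp k) / Kell k)

/-- The descending Landen transformation `k₁ = (1-k')/(1+k')`. -/
def kLanden (k : ℝ) : ℝ := (1 - kComp k) / (1 + kComp k)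

/-- `T_k = K(k')/(4K(k))`. -/
def Tell (k : ℝ) : ℝ := Kell (kComp k) / (4 * Kell k)

/-- The plane minus the two real slits `{z ∈ ℝ : z² ≥ κ}`. -/
def slitDom (κ : ℝ) : Set ℂ := {z : ℂ | ¬(z.im = 0 ∧ κ ≤ z.re ^ 2)}

/-- `v` is the analytic function `v_κ` on `ℂ ∖ {z ∈ ℝ : z² ≥ κ}` with `v 0 = 0` and
`v'(z) = 1/(4K(κ)√((κ-z²)(1-κz²)))`, the branch of the square root being positive on
`(-√κ, √κ)` (by analytic continuation this determines `v` uniquely). -/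
structure IsVmap (κ : ℝ) (v : ℂ → ℂ) : Prop where
  map_zero : v 0 = 0
  analytic : AnalyticOnNhd ℂ v (slitDom κ)
  deriv_real : ∀ x : ℝ, x ^ 2 < κ →
    HasDerivAt v ((1 / (4 * Kell κ * Real.sqrt ((κ - x ^ 2) * (1 - κ * x ^ 2))) : ℝ) : ℂ)
      (x : ℂ)

/-- The function `f_m(z) = cos(2πm(v(z) + 1/4)) - cos(πm/2)` built from `v = v_{k₁}`. -/
def fmFun (v : ℂ → ℂ) (m : ℕ) (z : ℂ) : ℂ :=
  Complex.cos (2 * (π : ℂ) * m * (v z + 1 / 4)) - Complex.cos ((π : ℂ) * m / 2)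

/-- `a n m` is the (real) Taylor coefficient `[zⁿ] f_m(z)` at `0`. -/
def IsCoeff (κ : ℝ) (v : ℂ → ℂ) (a : ℕ → ℕ → ℝ) : Prop :=
  ∀ m : ℕ, 1 ≤ m → ∀ z : ℂ, z ∈ slitDom κ → ‖z‖ < 1 →
    HasSum (fun n : ℕ => (a n m : ℂ) * z ^ n) (fmFun v m z)

/-- An excursion: a nonempty simple diagonal walk from the origin to the origin with no
intermediate visits to the origin. -/
def IsExcursion (w : List (ℤ × ℤ)) : Prop :=
  2 ≤ w.length ∧ w.Chain' IsDiagStep ∧ w.head? = some (0, 0) ∧ w.getLast? = some (0, 0) ∧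
    ∀ i, 1 ≤ i → i ≤ w.length - 2 → w.getD i 0 ≠ (0, 0)

/-- The winding angle sequence of an excursion: `θ₀ = θ₁ = 0`, increments of the first and
last step do not contribute, and `θ_n = θ_{n-1}`. -/
def windExcTo (w : List (ℤ × ℤ)) (i : ℕ) : ℝ :=
  ∑ j ∈ Finset.Icc 2 (min i (w.length - 2)), (ptC (w.getD j 0) / ptC (w.getD (j - 1) 0)).arg

/-- The full winding angle of an excursion. -/
def windExc (w : List (ℤ × ℤ)) : ℝ := windExcTo w (w.length - 1)

/-- `F^{(α)}(t)`: generating function of excursions with winding angle `α`. -/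
def Fgen (t α : ℝ) : ℝ :=
  ∑' w : {w : List (ℤ × ℤ) // IsExcursion w ∧ windExc w = α}, t ^ (w.val.length - 1)

/-- `F(t,b) = Σ_w t^{|w|} e^{i b θ^w}`, the characteristic function of excursions. -/
def Fchar (t b : ℝ) : ℂ :=
  ∑' w : {w : List (ℤ × ℤ) // IsExcursion w},
    (t : ℂ) ^ (w.val.length - 1) * Complex.exp (Complex.I * b * windExc w.val)

/-- `ψ_k(z) = (1 - √(1-kz²))/(√k z)` (principal square root), `ψ_k(0) = 0`. -/
def psiK (k : ℝ) (z : ℂ) : ℂ :=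
  if z = 0 then 0 else (1 - (1 - (k : ℂ) * z ^ 2) ^ ((1 : ℂ) / 2)) / ((Real.sqrt k : ℂ) * z)

/-- Functions holomorphic on the open unit disk and continuous on the closed one. -/
abbrev DiskAlg (f : ℂ → ℂ) : Prop := DiffContOnCl ℂ f (Metric.ball 0 1)

theorem DiskAlg.continuousOn_closedBall {f : ℂ → ℂ} (hf : DiskAlg f) :
    ContinuousOn f (Metric.closedBall 0 1) := by
  have := hf.continuousOn
  rwa [closure_ball _ one_ne_zero] at this

theorem DiskAlg.mul {f g : ℂ → ℂ} (hf : DiskAlg f) (hg : DiskAlg g) :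
    DiskAlg (fun x => f x * g x) := DiffContOnCl.smul hf hg

theorem DiskAlg.const (c : ℂ) : DiskAlg (fun _ => c) := diffContOnCl_const

theorem DiskAlg.id : DiskAlg (fun x => x) := differentiable_id.diffContOnCl

theorem DiskAlg.dslope {f : ℂ → ℂ} (hf : DiskAlg f) {c : ℂ} (hc : ‖c‖ < 1) :
    DiskAlg (dslope f c) := by
  have hb : Metric.ball (0 : ℂ) 1 ∈ nhds c := Metric.isOpen_ball.mem_nhds (by simpa using hc)
  refine ⟨(Complex.differentiableOn_dslope hb).2 hf.differentiableOn, ?_⟩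
  exact (continuousOn_dslope (Filter.mem_of_superset hb subset_closure)).2
    ⟨hf.continuousOn, hf.differentiableOn.differentiableAt hb⟩

/-- Division by a linear factor vanishing inside the disk and one vanishing outside. -/
theorem DiskAlg.exists_factor {f : ℂ → ℂ} (hf : DiskAlg f) {c d : ℂ} (hc : ‖c‖ < 1)
    (hd : 1 < ‖d‖) (h0 : f c = 0) :
    ∃ h : ℂ → ℂ, DiskAlg h ∧ ∀ z, ‖z‖ ≤ 1 → f z = (z - c) * (z - d) * h z := by
  have hne : ∀ z : ℂ, ‖z‖ ≤ 1 → z - d ≠ 0 := by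
    intro z hz h
    rw [sub_eq_zero] at h
    subst h
    linarith
  refine ⟨fun z => _root_.dslope f c z * (z - d)⁻¹, (hf.dslope hc).mul ?_, fun z hz => ?_⟩
  · refine DiffContOnCl.inv (f := fun z : ℂ => z - d) (DiskAlg.id.sub_const d) fun z hz => ?_
    rw [closure_ball _ one_ne_zero] at hz
    exact hne z (by simpa using hz)
  · have h1 := sub_smul_dslope f c z
    rw [h0, sub_zero, smul_eq_mul] at h1
    rw [← h1]
    field_simp [hne z hz]

/-- Fourier coefficients (up to the factor `2π`) of a function restricted to the unit circle. -/
def circleCoeff (f : ℂ → ℂ) (j : ℤ) : ℂ :=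
  ∫ θ in Ioc 0 (2 * π), f (circleMap 0 1 θ) * circleMap 0 1 θ ^ (-j)

theorem circleMap_unit_ne_zero (θ : ℝ) : circleMap 0 1 θ ≠ 0 :=
  circleMap_ne_center one_ne_zero

theorem norm_circleMap_unit (θ : ℝ) : ‖circleMap 0 1 θ‖ = 1 := by
  simp

theorem continuous_circleMap_zpow (j : ℤ) : Continuous fun θ : ℝ => circleMap 0 1 θ ^ j :=
  (continuous_circleMap 0 1).zpow₀ j fun θ => Or.inl (circleMap_unit_ne_zero θ)

theorem circleCoeff_eq_circleIntegral (f : ℂ → ℂ) (j : ℤ) :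
    circleCoeff f j = -I * ∮ z in C(0, 1), f z * z ^ (-j - 1) := by
  rw [circleCoeff, circleIntegral, intervalIntegral.integral_of_le (by positivity),
    ← MeasureTheory.integral_const_mul]
  congr 1
  ext θ
  rw [deriv_circleMap, zpow_sub_one₀ (circleMap_unit_ne_zero θ), smul_eq_mul]
  field_simp [circleMap_unit_ne_zero θ]
  rw [I_sq]
  ring

theorem circleCoeff_congr {f g : ℂ → ℂ} (h : ∀ z, ‖z‖ = 1 → f z = g z) (j : ℤ) :
    circleCoeff f j = circleCoeff g j := by
  unfold circleCoeff
  congr 1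
  ext θ
  rw [h _ (norm_circleMap_unit θ)]

theorem DiskAlg.circleCoeff_of_neg {f : ℂ → ℂ} (hf : DiskAlg f) {j : ℤ} (hj : j < 0) :
    circleCoeff f j = 0 := by
  obtain ⟨n, hn⟩ : ∃ n : ℕ, -j - 1 = n := ⟨(-j - 1).toNat, by omega⟩
  have hg : DiskAlg (fun z => f z * z ^ n) :=
    hf.mul (differentiable_id.pow n).diffContOnCl
  rw [circleCoeff_eq_circleIntegral, hn]
  simp only [zpow_natCast]
  rw [Complex.circleIntegral_eq_zero_of_differentiable_on_off_countable zero_le_one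
    Set.countable_empty hg.continuousOn_closedBall, mul_zero]
  intro z hz
  exact hg.differentiableOn.differentiableAt (Metric.isOpen_ball.mem_nhds hz.1)

theorem circleCoeff_id_mul (f : ℂ → ℂ) (j : ℤ) :
    circleCoeff (fun z => z * f z) j = circleCoeff f (j - 1) := by
  unfold circleCoeff
  congr 1
  ext θ
  rw [show -(j - 1) = 1 + -j by ring, zpow_add₀ (circleMap_unit_ne_zero θ), zpow_one]
  ring

theorem DiskAlg.circleCoeff_id_mul {f : ℂ → ℂ} (hf : DiskAlg f) {j : ℤ} (hj : j ≤ 0) :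
    circleCoeff (fun z => z * f z) j = 0 := by
  rw [_root_.circleCoeff_id_mul]
  exact hf.circleCoeff_of_neg (by omega)

theorem circleCoeff_one_zero : circleCoeff (fun _ => 1) 0 = 2 * π := by
  simp [circleCoeff, Real.pi_nonneg]

theorem circleCoeff_one_of_ne {j : ℤ} (hj : j ≠ 0) : circleCoeff (fun _ => 1) j = 0 := by
  rw [circleCoeff_eq_circleIntegral]
  have := circleIntegral.integral_sub_zpow_of_ne (n := -j - 1) (by omega) 0 0 1
  simp only [sub_zero] at this
  simp [this]

theorem DiskAlg.eq_const {f : ℂ → ℂ} (hf : DiskAlg f) (h : ∀ n : ℤ, 1 ≤ n → circleCoeff f n = 0)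
    {z : ℂ} (hz : ‖z‖ ≤ 1) : f z = f 0 := by
  have hb : EqOn f (fun _ => f 0) (Metric.ball 0 1) := by
    intro z hz
    have hs := (DiffContOnCl.hasFPowerSeriesOnBall (R := 1) (c := 0) (by simpa using hf)
      one_pos).hasSum (y := z) (by simpa [← ofReal_norm] using hz)
    rw [zero_add] at hs
    have hz0 : ∀ n : ℕ, n ≠ 0 → (cauchyPowerSeries f 0 (1 : NNReal) n fun _ => z) = 0 := by
      intro n hn
      rw [cauchyPowerSeries_apply]
      have h1 := h n (by omega)
      rw [circleCoeff_eq_circleIntegral, mul_eq_zero] at h1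
      have h2 := h1.resolve_left (neg_ne_zero.2 I_ne_zero)
      have h3 : (∮ w in C(0, 1), (z / (w - 0)) ^ n • (w - 0)⁻¹ • f w) =
          z ^ n * ∮ w in C(0, 1), f w * w ^ (-(n : ℤ) - 1) := by
        rw [← smul_eq_mul (z ^ n), ← circleIntegral.integral_smul]
        refine circleIntegral.integral_congr zero_le_one fun w hw => ?_
        have hw0 : w ≠ 0 := by
          rintro rfl
          simp at hw
        simp only [sub_zero, smul_eq_mul]
        rw [zpow_sub_one₀ hw0, zpow_neg, zpow_natCast, div_pow]
        ring
      simp only [NNReal.coe_one]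
      rw [h3, h2]
      simp
    have hs' := hs.unique (hasSum_single 0 fun n hn => hz0 n hn)
    have hs0 := (DiffContOnCl.hasFPowerSeriesOnBall (R := 1) (c := 0) (by simpa using hf)
      one_pos).coeff_zero fun _ => z
    rw [hs']
    simpa using hs0
  have hc : EqOn f (fun _ => f 0) (closure (Metric.ball 0 1)) :=
    hb.of_subset_closure hf.continuousOn continuousOn_const subset_closure subset_rfl
  exact hc (by rw [closure_ball _ one_ne_zero]; simpa using hz)

/-- Continuity on the unit torus, in angular coordinates. -/
def TorusContinuous (F : ℂ → ℂ → ℂ) : Prop :=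
  Continuous fun p : ℝ × ℝ => F (circleMap 0 1 p.1) (circleMap 0 1 p.2)

/-- Double Fourier coefficients (up to the factor `4π²`) on the unit torus. -/
def torusCoeff (F : ℂ → ℂ → ℂ) (i j : ℤ) : ℂ :=
  ∫ p in Ioc 0 (2 * π) ×ˢ Ioc 0 (2 * π), F (circleMap 0 1 p.1) (circleMap 0 1 p.2) *
    (circleMap 0 1 p.1 ^ (-i) * circleMap 0 1 p.2 ^ (-j))

theorem TorusContinuous.integrableOn {F : ℂ → ℂ → ℂ} (hF : TorusContinuous F) (i j : ℤ) :
    MeasureTheory.IntegrableOn (fun p : ℝ × ℝ => F (circleMap 0 1 p.1) (circleMap 0 1 p.2) *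
      (circleMap 0 1 p.1 ^ (-i) * circleMap 0 1 p.2 ^ (-j)))
      (Ioc 0 (2 * π) ×ˢ Ioc 0 (2 * π)) := by
  have hc : Continuous (fun p : ℝ × ℝ => F (circleMap 0 1 p.1) (circleMap 0 1 p.2) *
      (circleMap 0 1 p.1 ^ (-i) * circleMap 0 1 p.2 ^ (-j))) :=
    Continuous.mul hF (((continuous_circleMap_zpow (-i)).comp continuous_fst).mul
      ((continuous_circleMap_zpow (-j)).comp continuous_snd))
  exact (hc.continuousOn.integrableOn_compact (isCompact_Icc.prod isCompact_Icc)).mono_set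
    (Set.prod_mono Ioc_subset_Icc_self Ioc_subset_Icc_self)

theorem torusCoeff_congr {F G : ℂ → ℂ → ℂ} (h : ∀ x y, ‖x‖ = 1 → ‖y‖ = 1 → F x y = G x y)
    (i j : ℤ) : torusCoeff F i j = torusCoeff G i j := by
  unfold torusCoeff
  congr 1
  ext p
  rw [h _ _ (norm_circleMap_unit p.1) (norm_circleMap_unit p.2)]

theorem torusCoeff_eq_zero_right {F : ℂ → ℂ → ℂ} (hF : TorusContinuous F) (i j : ℤ)
    (h : ∀ x, ‖x‖ = 1 → circleCoeff (F x) j = 0) : torusCoeff F i j = 0 := by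
  unfold torusCoeff
  rw [MeasureTheory.Measure.volume_eq_prod, MeasureTheory.setIntegral_prod]
  · refine (MeasureTheory.integral_congr_ae (Filter.Eventually.of_forall fun α => ?_)).trans
      (MeasureTheory.integral_zero _ _)
    have h1 := h _ (norm_circleMap_unit α)
    unfold circleCoeff at h1
    refine Eq.trans ?_ ((congrArg (· * circleMap 0 1 α ^ (-i)) h1).trans (zero_mul _))
    rw [← MeasureTheory.integral_mul_const]
    congr 1
    ext β
    ring
  · exact hF.integrableOn i j

theorem torusCoeff_swap (F : ℂ → ℂ → ℂ) (i j : ℤ) :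
    torusCoeff (fun x y => F y x) j i = torusCoeff F i j := by
  unfold torusCoeff
  rw [MeasureTheory.Measure.volume_eq_prod, ← MeasureTheory.setIntegral_prod_swap]
  congr 1
  ext p
  simp only [Prod.fst_swap, Prod.snd_swap]
  ring

theorem torusCoeff_eq_zero_left {F : ℂ → ℂ → ℂ} (hF : TorusContinuous F) (i j : ℤ)
    (h : ∀ y, ‖y‖ = 1 → circleCoeff (fun x => F x y) i = 0) : torusCoeff F i j = 0 := by
  rw [← torusCoeff_swap]
  exact torusCoeff_eq_zero_right (F := fun x y => F y x) (Continuous.comp hF continuous_swap) j i h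

theorem torusCoeff_mul (f g : ℂ → ℂ) (i j : ℤ) :
    torusCoeff (fun x y => f x * g y) i j = circleCoeff f i * circleCoeff g j := by
  unfold torusCoeff circleCoeff
  rw [← MeasureTheory.setIntegral_prod_mul, MeasureTheory.Measure.volume_eq_prod]
  congr 1
  ext p
  ring

theorem torusCoeff_add {F G : ℂ → ℂ → ℂ} (hF : TorusContinuous F) (hG : TorusContinuous G)
    (i j : ℤ) : torusCoeff (fun x y => F x y + G x y) i j =
      torusCoeff F i j + torusCoeff G i j := by
  unfold torusCoeff
  rw [← MeasureTheory.integral_add (hF.integrableOn i j) (hG.integrableOn i j)]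
  congr 1
  ext p
  ring

theorem torusCoeff_const_mul (c : ℂ) (F : ℂ → ℂ → ℂ) (i j : ℤ) :
    torusCoeff (fun x y => c * F x y) i j = c * torusCoeff F i j := by
  unfold torusCoeff
  rw [← MeasureTheory.integral_const_mul]
  congr 1
  ext p
  ring

theorem torusCoeff_zpow_mul (m n : ℤ) (F : ℂ → ℂ → ℂ) (i j : ℤ) :
    torusCoeff (fun x y => x ^ m * y ^ n * F x y) i j = torusCoeff F (i - m) (j - n) := by
  unfold torusCoeff
  congr 1
  ext p
  rw [show -(i - m) = m + -i by ring, show -(j - n) = n + -j by ring,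
    zpow_add₀ (circleMap_unit_ne_zero p.1), zpow_add₀ (circleMap_unit_ne_zero p.2)]
  ring

theorem TorusContinuous.exists_bound {F : ℂ → ℂ → ℂ} (hF : TorusContinuous F) :
    ∃ C : ℝ, ∀ i j, ‖torusCoeff F i j‖ ≤ C := by
  obtain ⟨C, hC⟩ := (isCompact_Icc.prod isCompact_Icc).exists_bound_of_continuousOn
    (s := Icc 0 (2 * π) ×ˢ Icc 0 (2 * π)) hF.continuousOn
  refine ⟨_, fun i j => MeasureTheory.norm_setIntegral_le_of_norm_le_const (C := C) ?_
    fun p hp => ?_⟩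
  · rw [MeasureTheory.Measure.volume_eq_prod, MeasureTheory.Measure.prod_prod]
    exact ENNReal.mul_lt_top measure_Ioc_lt_top measure_Ioc_lt_top
  · rw [norm_mul, norm_mul, norm_zpow, norm_zpow, norm_circleMap_unit, norm_circleMap_unit,
      one_zpow, one_zpow, mul_one, mul_one]
    exact hC p (Set.prod_mono Ioc_subset_Icc_self Ioc_subset_Icc_self hp)

theorem TorusContinuous.add {F G : ℂ → ℂ → ℂ} (hF : TorusContinuous F) (hG : TorusContinuous G) :
    TorusContinuous fun x y => F x y + G x y := Continuous.add hF hG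

theorem TorusContinuous.mul {F G : ℂ → ℂ → ℂ} (hF : TorusContinuous F) (hG : TorusContinuous G) :
    TorusContinuous fun x y => F x y * G x y := Continuous.mul hF hG

theorem DiskAlg.continuous_circleMap {f : ℂ → ℂ} (hf : DiskAlg f) :
    Continuous fun θ : ℝ => f (circleMap 0 1 θ) :=
  hf.continuousOn_closedBall.comp_continuous (_root_.continuous_circleMap 0 1) fun θ => by simp

theorem DiskAlg.torusContinuous_fst {f : ℂ → ℂ} (hf : DiskAlg f) :
    TorusContinuous fun x _ => f x := hf.continuous_circleMap.comp continuous_fst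

theorem DiskAlg.torusContinuous_snd {f : ℂ → ℂ} (hf : DiskAlg f) :
    TorusContinuous fun _ y => f y := hf.continuous_circleMap.comp continuous_snd

theorem torusContinuous_zpow (m n : ℤ) : TorusContinuous fun x y => x ^ m * y ^ n :=
  ((continuous_circleMap_zpow m).comp continuous_fst).mul
    ((continuous_circleMap_zpow n).comp continuous_snd)

/-- A small root of the kernel over each point of the unit circle. -/
theorem exists_small_root {t : ℝ} (ht : t ∈ Ioo (0 : ℝ) (1 / 4)) {x : ℂ} (hx : ‖x‖ = 1) :
    ∃ y : ℂ, y ≠ 0 ∧ ‖y‖ < 1 ∧ x + x⁻¹ + y + y⁻¹ = (t : ℂ)⁻¹ := by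
  set c : ℂ := (t : ℂ)⁻¹ - x - x⁻¹ with hc
  have hcn : 2 < ‖c‖ := by
    have h1 : ‖(t : ℂ)⁻¹‖ ≤ ‖c‖ + ‖x‖ + ‖x⁻¹‖ := by
      calc ‖(t : ℂ)⁻¹‖ = ‖c + x + x⁻¹‖ := by rw [hc]; ring_nf
        _ ≤ _ := norm_add₃_le
    rw [norm_inv, norm_inv, hx, norm_real, Real.norm_of_nonneg ht.1.le] at h1
    have h2 : 4 < t⁻¹ := by
      rw [lt_inv_comm₀ (by norm_num) ht.1]
      linarith [ht.2]
    norm_num at h1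
    linarith
  obtain ⟨d, hd⟩ := IsAlgClosed.exists_pow_nat_eq (c ^ 2 - 4) (n := 2) two_pos
  have key : ∀ u v : ℂ, u * v = 1 → u + v = c → ‖u‖ < 1 →
      ∃ y : ℂ, y ≠ 0 ∧ ‖y‖ < 1 ∧ x + x⁻¹ + y + y⁻¹ = (t : ℂ)⁻¹ := by
    intro u v huv hs hu
    refine ⟨u, left_ne_zero_of_mul_eq_one huv, hu, ?_⟩
    rw [← eq_inv_of_mul_eq_one_right huv, add_assoc, hs, hc]
    ring
  have hp : (c + d) / 2 * ((c - d) / 2) = 1 := by linear_combination (-1 / 4 : ℂ) * hd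
  have hn := congrArg norm hp
  rw [norm_mul, norm_one] at hn
  rcases lt_or_ge ‖(c + d) / 2‖ 1 with h | h
  · exact key _ _ hp (by ring) h
  · refine key _ _ ((mul_comm _ _).trans hp) (by ring) ?_
    by_contra! h'
    have h1 : ‖(c + d) / 2‖ ≤ 1 := by nlinarith
    have h2 : ‖(c - d) / 2‖ ≤ 1 := by nlinarith
    have := norm_add_le ((c + d) / 2) ((c - d) / 2)
    rw [show (c + d) / 2 + (c - d) / 2 = c by ring] at this
    linarith

section

/-- The function `a x + b x / y` on the kernel curve `x + 1/x + y + 1/y = 1/t` is multiplied by `s`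
under the order-four automorphism `(x, y) ↦ (y, 1/x)`. -/
def IsSection (t : ℝ) (s : ℂ) (a b : ℂ → ℂ) : Prop :=
  ∀ x y : ℂ, x ≠ 0 → y ≠ 0 → ‖x‖ ≤ 1 → ‖y‖ ≤ 1 → x + x⁻¹ + y + y⁻¹ = (t : ℂ)⁻¹ →
    s * (a x + b x * y⁻¹) = a y + b y * x

theorem one_lt_norm_inv {y : ℂ} (h0 : y ≠ 0) (h : ‖y‖ < 1) : 1 < ‖y⁻¹‖ := by
  rw [norm_inv]
  exact (one_lt_inv₀ (norm_pos_iff.2 h0)).2 h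

theorem kernel_ne_zero {t : ℝ} (ht : t ∈ Ioo (0 : ℝ) (1 / 4)) {x y : ℂ} (hx : ‖x‖ = 1)
    (hy : ‖y‖ = 1) : 1 - (t : ℂ) * (x + x⁻¹ + y + y⁻¹) ≠ 0 := by
  intro h
  have h1 : ‖x + x⁻¹ + y + y⁻¹‖ ≤ 4 := by
    refine norm_add₄_le.trans ?_
    rw [norm_inv, norm_inv, hx, hy]
    norm_num
  have h2 : ‖(t : ℂ) * (x + x⁻¹ + y + y⁻¹)‖ = 1 := by
    rw [← sub_eq_zero.1 h, norm_one]
  rw [norm_mul, norm_real, Real.norm_of_nonneg ht.1.le] at h2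
  nlinarith [ht.1, ht.2]

/-- Dividing by the kernel, for a function vanishing at its small root. -/
theorem DiskAlg.exists_eq_mul_kernel {t : ℝ} (ht : t ∈ Ioo (0 : ℝ) (1 / 4)) {f : ℂ → ℂ}
    (hf : DiskAlg f) {x : ℂ} (hx : ‖x‖ = 1)
    (h0 : ∀ y : ℂ, y ≠ 0 → ‖y‖ < 1 → x + x⁻¹ + y + y⁻¹ = (t : ℂ)⁻¹ → f y = 0) :
    ∃ h : ℂ → ℂ, DiskAlg h ∧ ∀ y, ‖y‖ = 1 →
      f y * (1 - (t : ℂ) * (x + x⁻¹ + y + y⁻¹))⁻¹ = y * h y := by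
  obtain ⟨c, hc0, hc1, hc⟩ := exists_small_root ht hx
  obtain ⟨h, hh, he⟩ := hf.exists_factor hc1 (one_lt_norm_inv hc0 hc1) (h0 c hc0 hc1 hc)
  have ht0 : (t : ℂ) ≠ 0 := ofReal_ne_zero.2 ht.1.ne'
  refine ⟨fun y => -(t : ℂ)⁻¹ * h y, (DiskAlg.const _).mul hh, fun y hy => ?_⟩
  have hy0 : y ≠ 0 := norm_pos_iff.1 (by rw [hy]; exact one_pos)
  rw [mul_inv_eq_iff_eq_mul₀ (kernel_ne_zero ht hx hy), he y hy.le]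
  have hk : 1 - (t : ℂ) * (x + x⁻¹ + y + y⁻¹) = (t : ℂ) * (c + c⁻¹ - y - y⁻¹) := by
    have : (t : ℂ) * (x + x⁻¹ + c + c⁻¹) = 1 := by rw [hc, mul_inv_cancel₀ ht0]
    linear_combination -this
  rw [hk]
  field_simp
  ring

variable {t : ℝ} {s : ℂ} {A C : ℂ → ℂ}

/-- The defect of the section equation. -/
def sectionDefect (s : ℂ) (A C : ℂ → ℂ) (x y : ℂ) : ℂ :=
  A x + C x * y⁻¹ - s⁻¹ * (A y + C y * x)

theorem IsSection.defect_eq_zero (h : IsSection t s A C) (hs : s ≠ 0) {x y : ℂ} (hx0 : x ≠ 0)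
    (hy0 : y ≠ 0) (hx : ‖x‖ ≤ 1) (hy : ‖y‖ ≤ 1) (hxy : x + x⁻¹ + y + y⁻¹ = (t : ℂ)⁻¹) :
    sectionDefect s A C x y = 0 := by
  have := h x y hx0 hy0 hx hy hxy
  rw [sectionDefect, ← this, inv_mul_cancel_left₀ hs, sub_self]

theorem torusContinuous_sectionDefect (hA : DiskAlg A) (hC : DiskAlg C) :
    TorusContinuous (sectionDefect s A C) := by
  have h1 : Continuous fun p : ℝ × ℝ => circleMap 0 1 p.1 :=
    (continuous_circleMap 0 1).comp continuous_fst
  have h2 : Continuous fun p : ℝ × ℝ => (circleMap 0 1 p.2)⁻¹ :=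
    ((continuous_circleMap 0 1).comp continuous_snd).inv₀ fun p => circleMap_unit_ne_zero _
  exact (Continuous.add hA.torusContinuous_fst (Continuous.mul hC.torusContinuous_fst h2)).sub
    (continuous_const.mul (Continuous.add hA.torusContinuous_snd
      (Continuous.mul hC.torusContinuous_snd h1)))

theorem torusContinuous_defect_div_kernel (ht : t ∈ Ioo (0 : ℝ) (1 / 4)) (hA : DiskAlg A)
    (hC : DiskAlg C) : TorusContinuous fun x y =>
      sectionDefect s A C x y * (1 - (t : ℂ) * (x + x⁻¹ + y + y⁻¹))⁻¹ := by
  refine Continuous.mul (torusContinuous_sectionDefect hA hC) (Continuous.inv₀ ?_ fun p =>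
    kernel_ne_zero ht (norm_circleMap_unit _) (norm_circleMap_unit _))
  have h1 : Continuous fun p : ℝ × ℝ => circleMap 0 1 p.1 :=
    (continuous_circleMap 0 1).comp continuous_fst
  have h2 : Continuous fun p : ℝ × ℝ => circleMap 0 1 p.2 :=
    (continuous_circleMap 0 1).comp continuous_snd
  have h1' := h1.inv₀ fun p => circleMap_unit_ne_zero _
  have h2' := h2.inv₀ fun p => circleMap_unit_ne_zero _
  exact continuous_const.sub (continuous_const.mul (((h1.add h1').add h2).add h2'))

theorem circleCoeff_id (j : ℤ) : circleCoeff (fun z => z) j = circleCoeff (fun _ => 1) (j - 1) := by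
  rw [← circleCoeff_id_mul]
  simp

theorem circleCoeff_inv (j : ℤ) : circleCoeff (fun z => z⁻¹) j =
    circleCoeff (fun _ => 1) (j + 1) := by
  have := circleCoeff_id_mul (fun z => z⁻¹) (j + 1)
  rw [add_sub_cancel_right] at this
  rw [← this]
  refine circleCoeff_congr (fun z hz => ?_) _
  exact mul_inv_cancel₀ (norm_pos_iff.1 (by rw [hz]; exact one_pos))

theorem torusCoeff_sectionDefect (hA : DiskAlg A) (hC : DiskAlg C) (i j : ℤ) :
    torusCoeff (sectionDefect s A C) i j =
      circleCoeff A i * circleCoeff (fun _ => 1) j + circleCoeff C i * circleCoeff (fun _ =>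
          1) (j + 1)
      - s⁻¹ * (circleCoeff (fun _ => 1) i * circleCoeff A j +
        circleCoeff (fun _ => 1) (i - 1) * circleCoeff C j) := by
  have e : ∀ x y, sectionDefect s A C x y = (A x * 1 + C x * y⁻¹) +
      (-s⁻¹) * (1 * A y + x * C y) := fun x y => by rw [sectionDefect]; ring
  have cinv : TorusContinuous fun _ y => y⁻¹ :=
    ((continuous_circleMap 0 1).comp continuous_snd).inv₀ fun p => circleMap_unit_ne_zero _
  have cid : TorusContinuous fun x _ => x := DiskAlg.id.torusContinuous_fst
  have c1 : TorusContinuous fun _ _ => 1 := continuous_const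
  have f1 : TorusContinuous fun x _ => A x * 1 := hA.torusContinuous_fst.mul c1
  have f2 : TorusContinuous fun x y => C x * y⁻¹ := hC.torusContinuous_fst.mul cinv
  have f3 : TorusContinuous fun _ y => 1 * A y := c1.mul hA.torusContinuous_snd
  have f4 : TorusContinuous fun x y => x * C y := cid.mul hC.torusContinuous_snd
  have f5 : TorusContinuous fun x y => (-s⁻¹) * (1 * A y + x * C y) :=
    Continuous.mul continuous_const (f3.add f4)
  rw [torusCoeff_congr fun x y _ _ => e x y, torusCoeff_add (f1.add f2) f5, torusCoeff_add f1 f2,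
    torusCoeff_const_mul, torusCoeff_add f3 f4, torusCoeff_mul A fun _ => 1, torusCoeff_mul C,
    torusCoeff_mul (fun _ => 1) A, torusCoeff_mul (fun x => x) C, circleCoeff_id, circleCoeff_inv]
  ring

theorem torusCoeff_mul_kernel {Q : ℂ → ℂ → ℂ} (hQ : TorusContinuous Q) (i j : ℤ) :
    torusCoeff (fun x y => Q x y * (1 - (t : ℂ) * (x + x⁻¹ + y + y⁻¹))) i j =
      torusCoeff Q i j - t * (torusCoeff Q (i - 1) j + torusCoeff Q (i + 1) j +
        torusCoeff Q i (j - 1) + torusCoeff Q i (j + 1)) := by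
  have e : ∀ x y, Q x y * (1 - (t : ℂ) * (x + x⁻¹ + y + y⁻¹)) =
      Q x y + (-t : ℂ) * (((x ^ (1 : ℤ) * y ^ (0 : ℤ) * Q x y + x ^ (-1 : ℤ) * y ^
          (0 : ℤ) * Q x y) +
        x ^ (0 : ℤ) * y ^ (1 : ℤ) * Q x y) + x ^ (0 : ℤ) * y ^ (-1 : ℤ) * Q x y) := by
    intro x y
    simp only [zpow_one, zpow_zero, zpow_neg_one]
    ring
  have f := fun m n => (torusContinuous_zpow m n).mul hQ
  have ct : TorusContinuous fun _ _ => (-t : ℂ) := continuous_const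
  rw [torusCoeff_congr fun x y _ _ => e x y, torusCoeff_add hQ
    (ct.mul (((((f 1 0).add (f (-1) 0)).add (f 0 1)).add (f 0 (-1))))),
    torusCoeff_const_mul, torusCoeff_add (((f 1 0).add (f (-1) 0)).add (f 0 1)) (f 0 (-1)),
    torusCoeff_add ((f 1 0).add (f (-1) 0)) (f 0 1), torusCoeff_add (f 1 0) (f (-1) 0)]
  simp only [torusCoeff_zpow_mul, sub_zero, sub_neg_eq_add]
  ring

/-- A bounded family which contracts by a factor `< 1` vanishes. -/
theorem eq_zero_of_contraction {ι : Type*} {q : ι → ℂ} {C r : ℝ} (hr0 : 0 ≤ r) (hr : r < 1)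
    (hb : ∀ i, ‖q i‖ ≤ C) (h : ∀ M, 0 ≤ M → (∀ i, ‖q i‖ ≤ M) → ∀ i, ‖q i‖ ≤ r * M) (i : ι) :
    q i = 0 := by
  have hC : 0 ≤ C := (norm_nonneg _).trans (hb i)
  have hk : ∀ k : ℕ, ∀ i, ‖q i‖ ≤ r ^ k * C := by
    intro k
    induction k with
    | zero => simpa using hb
    | succ k ih =>
      intro i
      rw [pow_succ', mul_assoc]
      exact h _ (by positivity) ih i
  have hl : Filter.Tendsto (fun k : ℕ => r ^ k * C) Filter.atTop (nhds 0) := by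
    simpa using (tendsto_pow_atTop_nhds_zero_of_lt_one hr0 hr).mul_const C
  exact norm_le_zero_iff.1 (ge_of_tendsto' hl fun k => hk k i)

/-- Sections without poles are constant. -/
theorem IsSection.eq_const (ht : t ∈ Ioo (0 : ℝ) (1 / 4)) (hs : ‖s‖ = 1) {A B : ℂ → ℂ}
    (hA : DiskAlg A) (hB : DiskAlg B) (h : IsSection t s A fun x => x * B x) {z : ℂ}
    (hz : ‖z‖ ≤ 1) : A z = A 0 ∧ z * B z = 0 := by
  have hs0 : s ≠ 0 := norm_pos_iff.1 (by rw [hs]; exact one_pos)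
  set C : ℂ → ℂ := fun x => x * B x with hCdef
  have hC : DiskAlg C := DiskAlg.id.mul hB
  set Q : ℂ → ℂ → ℂ := fun x y =>
    sectionDefect s A C x y * (1 - (t : ℂ) * (x + x⁻¹ + y + y⁻¹))⁻¹ with hQdef
  have hQ : TorusContinuous Q := torusContinuous_defect_div_kernel ht hA hC
  set q := torusCoeff Q with hq
  set o := circleCoeff fun _ => 1
  have o_ne : ∀ j : ℤ, j ≠ 0 → o j = 0 := fun j hj => circleCoeff_one_of_ne hj
  have o_zero : o 0 = 2 * π := circleCoeff_one_zero
  set α := circleCoeff A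
  set β := circleCoeff C
  have β_nonpos : ∀ j : ℤ, j ≤ 0 → β j = 0 := fun j hj => hB.circleCoeff_id_mul hj
  have unit_ne : ∀ x : ℂ, ‖x‖ = 1 → x ≠ 0 := fun x hx =>
    norm_pos_iff.1 (by rw [hx]; exact one_pos)
  have q_right : ∀ i j : ℤ, j < 0 → q i j = 0 := by
    intro i j hj
    refine torusCoeff_eq_zero_right hQ i j fun x hx => ?_
    have hf : DiskAlg fun y => y * A x + C x + -s⁻¹ * (y * (A y + C y * x)) :=
      ((DiskAlg.id.mul (DiskAlg.const (A x))).add (DiskAlg.const (C x))).add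
        ((DiskAlg.const (-s⁻¹)).mul (DiskAlg.id.mul (hA.add (hC.mul (DiskAlg.const x)))))
    have hN : ∀ y : ℂ, y ≠ 0 → y * A x + C x + -s⁻¹ * (y * (A y + C y * x)) =
        y * sectionDefect s A C x y := by
      intro y hy
      rw [sectionDefect]
      field_simp
      ring
    obtain ⟨g, hg, hgQ⟩ := hf.exists_eq_mul_kernel ht hx fun y hy0 hy hxy => by
      rw [hN y hy0, h.defect_eq_zero hs0 (unit_ne x hx) hy0 hx.le hy.le hxy, mul_zero]
    rw [circleCoeff_congr (g := g) fun y hy => ?_]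
    · exact hg.circleCoeff_of_neg hj
    · have h1 := hgQ y hy
      rw [hN y (unit_ne y hy), mul_assoc] at h1
      exact mul_left_cancel₀ (unit_ne y hy) h1
  have q_left : ∀ i j : ℤ, i ≤ 0 → q i j = 0 := by
    intro i j hi
    refine torusCoeff_eq_zero_left hQ i j fun y hy => ?_
    have hf : DiskAlg fun x => A x + C x * y⁻¹ + -s⁻¹ * (A y + C y * x) :=
      (hA.add (hC.mul (DiskAlg.const _))).add
        ((DiskAlg.const _).mul ((DiskAlg.const _).add ((DiskAlg.const _).mul DiskAlg.id)))
    have hN : ∀ x : ℂ, A x + C x * y⁻¹ + -s⁻¹ * (A y + C y * x) = sectionDefect s A C x y := by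
      intro x
      rw [sectionDefect]
      ring
    obtain ⟨g, hg, hgQ⟩ := hf.exists_eq_mul_kernel ht hy fun x hx0 hx hxy => by
      rw [hN x, h.defect_eq_zero hs0 hx0 (unit_ne y hy) hx.le hy.le (by rw [← hxy]; ring)]
    rw [circleCoeff_congr (g := fun x => x * g x) fun x hx => ?_]
    · exact hg.circleCoeff_id_mul hi
    · rw [← hgQ x hx, hN x, hQdef]
      ring_nf
  have rel : ∀ i j : ℤ, α i * o j + β i * o (j + 1) - s⁻¹ * (o i * α j + o (i - 1) * β j) =
      q i j - t * (q (i - 1) j + q (i + 1) j + q i (j - 1) + q i (j + 1)) := by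
    intro i j
    rw [← torusCoeff_sectionDefect hA hC, hq, ← torusCoeff_mul_kernel hQ]
    refine torusCoeff_congr (fun x y hx hy => ?_) i j
    rw [hQdef]
    simp only
    rw [inv_mul_cancel_right₀ (kernel_ne_zero ht hx hy)]
  have hα1 : ∀ j : ℤ, 1 ≤ j → 2 * π * α j = s * t * q 1 j := by
    intro j hj
    have := rel 0 j
    rw [o_ne j (by omega), o_ne (j + 1) (by omega), o_zero, o_ne (0 - 1) (by omega),
      q_left 0 j le_rfl, q_left (0 - 1) j (by omega), q_left 0 (j - 1) le_rfl,
      q_left 0 (j + 1) le_rfl, zero_add, zero_add] at this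
    field_simp at this
    linear_combination (-1) * this
  have hβ1 : ∀ i : ℤ, 1 ≤ i → 2 * π * β i = -t * q i 0 := by
    intro i hi
    have := rel i (-1)
    rw [o_ne (-1) (by omega), show (-1 : ℤ) + 1 = 0 by rfl, o_zero, β_nonpos (-1) (by omega),
      o_ne i (by omega), q_right i (-1) (by omega), q_right (i - 1) (-1) (by omega),
      q_right (i + 1) (-1) (by omega), q_right i (-1 - 1) (by omega)] at this
    linear_combination this
  have q_zero : ∀ p : ℤ × ℤ, q p.1 p.2 = 0 := by
    obtain ⟨K, hK⟩ := hQ.exists_bound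
    refine eq_zero_of_contraction (q := fun p : ℤ × ℤ => q p.1 p.2) (C := K) (r := 4 * t)
      (by linarith [ht.1]) (by linarith [ht.2]) (fun p => hK p.1 p.2) ?_
    rintro M hM0 hM ⟨i, j⟩
    have hM' : ∀ i j, ‖q i j‖ ≤ M := fun i j => hM (i, j)
    simp only
    have ht0 := ht.1
    rcases le_or_gt i 0 with hi | hi
    · rw [q_left i j hi, norm_zero]
      positivity
    rcases lt_or_ge j 0 with hj | hj
    · rw [q_right i j hj, norm_zero]
      positivity
    obtain ⟨a, b, ha, hb, he⟩ : ∃ a b : ℂ, ‖a‖ ≤ M ∧ ‖b‖ ≤ M ∧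
        q i j = t * (a + q (i + 1) j + b + q i (j + 1)) := by
      have hr := rel i j
      rw [o_ne i (by omega), o_ne (j + 1) (by omega)] at hr
      refine ⟨if i = 1 then s⁻¹ * q j 0 else q (i - 1) j, if j = 0 then s * q 1 i else q i (j - 1),
        ?_, ?_, ?_⟩
      · split_ifs
        · rw [norm_mul, norm_inv, hs, inv_one, one_mul]
          exact hM' _ _
        · exact hM' _ _
      · split_ifs
        · rw [norm_mul, hs, one_mul]
          exact hM' _ _
        · exact hM' _ _
      have e1 : α i * o j = if j = 0 then s * t * q 1 i else 0 := by
        split_ifs with hj0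
        · rw [hj0, o_zero, ← hα1 i (by omega)]
          ring
        · rw [o_ne j hj0, mul_zero]
      have e2 : -s⁻¹ * (o (i - 1) * β j) = if i = 1 then s⁻¹ * t * q j 0 else 0 := by
        split_ifs with hi1
        · rw [hi1, sub_self, o_zero]
          rcases hj.eq_or_lt with hj0 | hj0
          · rw [← hj0, β_nonpos 0 le_rfl, q_left 0 0 le_rfl]
            ring
          · rw [hβ1 j hj0]
            ring
        · rw [o_ne (i - 1) (by omega)]
          ring
      have e3 : i = 1 → q (i - 1) j = 0 := fun h => q_left _ _ (by omega)
      have e4 : j = 0 → q i (j - 1) = 0 := fun h => q_right _ _ (by omega)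
      split_ifs at e1 e2 ⊢ with hi1 hj0 hj0
      · rw [e3 hi1, e4 hj0] at hr
        linear_combination -hr + e1 + e2
      · rw [e3 hi1] at hr
        linear_combination -hr + e1 + e2
      · rw [e4 hj0] at hr
        linear_combination -hr + e1 + e2
      · linear_combination -hr + e1 + e2
    rw [he, norm_mul, norm_real, Real.norm_of_nonneg ht0.le, mul_comm 4 t, mul_assoc]
    refine mul_le_mul_of_nonneg_left (norm_add₄_le.trans ?_) ht0.le
    linarith [hM' (i + 1) j, hM' i (j + 1)]
  have two_pi : (2 * π : ℂ) ≠ 0 := by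
    simp [Real.pi_ne_zero]
  refine ⟨hA.eq_const (fun n hn => ?_) hz, ?_⟩
  · refine (mul_eq_zero.1 ((hα1 n hn).trans ?_)).resolve_left two_pi
    rw [q_zero (1, n), mul_zero]
  · have := hC.eq_const (fun n hn => ?_) hz
    · simpa [hCdef] using this
    · refine (mul_eq_zero.1 ((hβ1 n hn).trans ?_)).resolve_left two_pi
      rw [q_zero (n, 0), mul_zero]

end

section

theorem DiskAlg.add {f g : ℂ → ℂ} (hf : DiskAlg f) (hg : DiskAlg g) :
    DiskAlg (fun x => f x + g x) := DiffContOnCl.add hf hg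

theorem DiskAlg.sub {f g : ℂ → ℂ} (hf : DiskAlg f) (hg : DiskAlg g) :
    DiskAlg (fun x => f x - g x) := DiffContOnCl.sub hf hg

/-- Points of the kernel curve with both coordinates in the punctured closed unit disk. -/
structure OnCurve (t : ℝ) (x y : ℂ) : Prop where
  fst_ne : x ≠ 0
  snd_ne : y ≠ 0
  fst_le : ‖x‖ ≤ 1
  snd_le : ‖y‖ ≤ 1
  eq : x + x⁻¹ + y + y⁻¹ = (t : ℂ)⁻¹

/-- The function on the kernel curve attached to a pair of functions of the first coordinate. -/
def sectionVal (a b : ℂ → ℂ) (x y : ℂ) : ℂ := a x + b x * y⁻¹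

variable {t : ℝ} {s r κ κ' μ μ' : ℂ} {a b a' b' : ℂ → ℂ}

theorem IsSection.congr (h : IsSection t s a b)
    (ha : ∀ x, x ≠ 0 → ‖x‖ ≤ 1 → a' x = a x) (hb : ∀ x, x ≠ 0 → ‖x‖ ≤ 1 → b' x = b x) :
    IsSection t s a' b' := by
  intro x y hx0 hy0 hx hy hxy
  rw [ha x hx0 hx, hb x hx0 hx, ha y hy0 hy, hb y hy0 hy]
  exact h x y hx0 hy0 hx hy hxy

theorem IsSection.sub (h : IsSection t s a b) (h' : IsSection t s a' b') :
    IsSection t s (fun x => a x - a' x) (fun x => b x - b' x) := by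
  intro x y hx0 hy0 hx hy hxy
  linear_combination h x y hx0 hy0 hx hy hxy - h' x y hx0 hy0 hx hy hxy

theorem IsSection.const_mul (c : ℂ) (h : IsSection t s a b) :
    IsSection t s (fun x => c * a x) (fun x => c * b x) := by
  intro x y hx0 hy0 hx hy hxy
  linear_combination c * h x y hx0 hy0 hx hy hxy

/-- The second component of a product of two sections. -/
def mulSnd (t : ℝ) (a b a' b' : ℂ → ℂ) (x : ℂ) : ℂ :=
  a x * b' x + a' x * b x + b x * b' x * ((t : ℂ)⁻¹ - x - x⁻¹)

theorem sectionVal_mul {x y : ℂ} (h : OnCurve t x y) :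
    sectionVal (fun x => a x * a' x - b x * b' x) (mulSnd t a b a' b') x y =
      sectionVal a b x y * sectionVal a' b' x y := by
  have h1 : y * y⁻¹ = 1 := mul_inv_cancel₀ h.snd_ne
  simp only [sectionVal, mulSnd]
  linear_combination b x * b' x * h1 - b x * b' x * y⁻¹ * h.eq

theorem IsSection.mul (h : IsSection t s a b) (h' : IsSection t r a' b') :
    IsSection t (s * r) (fun x => a x * a' x - b x * b' x) (mulSnd t a b a' b') := by
  intro x y hx0 hy0 hx hy hxy
  have e := sectionVal_mul (a := a) (b := b) (a' := a') (b' := b') ⟨hx0, hy0, hx, hy, hxy⟩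
  have h1 := h x y hx0 hy0 hx hy hxy
  have h2 := h' x y hx0 hy0 hx hy hxy
  have h3 : x * x⁻¹ = 1 := mul_inv_cancel₀ hx0
  simp only [sectionVal] at e
  rw [e, mul_mul_mul_comm, h1, h2, mulSnd]
  linear_combination b y * b' y * x * hxy - b y * b' y * h3

theorem IsSection.flip (hs : s ≠ 0) (h : IsSection t s a b) :
    IsSection t s⁻¹ (fun x => a x + b x * ((t : ℂ)⁻¹ - x - x⁻¹)) (fun x => -b x) := by
  intro x y hx0 hy0 hx hy hxy
  have h1 := h y x hy0 hx0 hy hx (by rw [← hxy]; ring)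
  have h2 : s⁻¹ * (a x + b x * y) = a y + b y * x⁻¹ := by
    rw [← h1, inv_mul_cancel_left₀ hs]
  rw [← hxy]
  linear_combination h2

/-- Sections with a simple pole at `x = 0`. -/
structure IsSimple (t : ℝ) (s κ : ℂ) (a b : ℂ → ℂ) : Prop where
  sect : IsSection t s a b
  expand : ∃ a₂ b₂ : ℂ → ℂ, DiskAlg a₂ ∧ DiskAlg b₂ ∧ ∀ x, x ≠ 0 → ‖x‖ ≤ 1 →
    a x = x⁻¹ + κ + x * a₂ x ∧
      b x = 1 + s⁻¹ + x * ((t : ℂ)⁻¹ + κ * (1 - s⁻¹)) + x ^ 2 * b₂ x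

/-- Sections with a double pole at `x = 0`. -/
structure IsDouble (t : ℝ) (s μ : ℂ) (a b : ℂ → ℂ) : Prop where
  sect : IsSection t s a b
  expand : ∃ a₃ b₃ : ℂ → ℂ, DiskAlg a₃ ∧ DiskAlg b₃ ∧ ∀ x, x ≠ 0 → ‖x‖ ≤ 1 →
    a x = (x⁻¹) ^ 2 + μ * x⁻¹ + a₃ x ∧
      b x = (1 - s⁻¹) * x⁻¹ + (1 + s⁻¹) * (μ + (t : ℂ)⁻¹) + x * b₃ x

theorem IsSimple.mul (h : IsSimple t s κ a b) (h' : IsSimple t r κ' a' b') :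
    IsDouble t (s * r) (κ + κ') (fun x => a x * a' x - b x * b' x) (mulSnd t a b a' b') := by
  obtain ⟨a₂, b₂, ha, hb, e⟩ := h.expand
  obtain ⟨a₂', b₂', ha', hb', e'⟩ := h'.expand
  refine ⟨h.sect.mul h'.sect, ?_⟩
  generalize hβ : (t : ℂ)⁻¹ + κ * (1 - s⁻¹) = β at e
  generalize hβ' : (t : ℂ)⁻¹ + κ' * (1 - r⁻¹) = β' at e'
  set R : ℂ → ℂ := fun x => β * β' + (1 + s⁻¹) * b₂' x + (1 + r⁻¹) * b₂ x +
    x * (β * b₂' x + β' * b₂ x) + x * x * (b₂ x * b₂' x) with hR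
  set b₁ : ℂ → ℂ := fun x => 1 + s⁻¹ + x * β + x * x * b₂ x with hb₁
  set b₁' : ℂ → ℂ := fun x => 1 + r⁻¹ + x * β' + x * x * b₂' x with hb₁'
  refine ⟨fun x => κ * κ' + a₂ x + a₂' x + x * (κ * a₂' x + κ' * a₂ x) + x * x * (a₂ x * a₂' x) -
      b₁ x * b₁' x, fun x => b₂ x + b₂' x + κ * (β' + x * b₂' x) + κ' * (β + x * b₂ x) +
      a₂ x * b₁' x + a₂' x * b₁ x +
      ((1 + s⁻¹) * β' + (1 + r⁻¹) * β + x * R x) * (t : ℂ)⁻¹ - b₁ x * b₁' x - R x, ?_, ?_, ?_⟩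
  · repeat' first | assumption | exact DiskAlg.const _ | exact DiskAlg.id | apply DiskAlg.mul |
      apply DiskAlg.add | apply DiskAlg.sub
  · repeat' first | assumption | exact DiskAlg.const _ | exact DiskAlg.id | apply DiskAlg.mul |
      apply DiskAlg.add | apply DiskAlg.sub
  · intro x hx0 hx
    rw [mulSnd, (e x hx0 hx).1, (e x hx0 hx).2, (e' x hx0 hx).1, (e' x hx0 hx).2, mul_inv,
      hR, hb₁, hb₁']
    simp only
    constructor
    · field_simp
      ring
    · rw [← hβ, ← hβ']
      field_simp
      ring

theorem IsSection.sub_eq_const (ht : t ∈ Ioo (0 : ℝ) (1 / 4)) (hs : ‖s‖ = 1) {A B : ℂ → ℂ}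
    (h : IsSection t s a b) (hA : DiskAlg A) (hB : DiskAlg B)
    (e : ∀ x, x ≠ 0 → ‖x‖ ≤ 1 → a x = A x ∧ b x = x * B x) :
    ∀ x y, OnCurve t x y → sectionVal a b x y = A 0 ∧ s * A 0 = A 0 := by
  have h' : IsSection t s A fun x => x * B x :=
    h.congr (fun x hx0 hx => ((e x hx0 hx).1).symm) fun x hx0 hx => ((e x hx0 hx).2).symm
  intro x y hxy
  have h1 := h'.eq_const ht hs hA hB hxy.fst_le
  have h2 := h'.eq_const ht hs hA hB hxy.snd_le
  have h3 := h' x y hxy.fst_ne hxy.snd_ne hxy.fst_le hxy.snd_le hxy.eq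
  simp only at h3
  rw [sectionVal, (e x hxy.fst_ne hxy.fst_le).1, (e x hxy.fst_ne hxy.fst_le).2, h1.2, h1.1]
  rw [h1.2, h1.1, h2.2, h2.1] at h3
  simp only [zero_mul, add_zero] at h3
  exact ⟨by ring, h3⟩

theorem IsDouble.sub_eq (ht : t ∈ Ioo (0 : ℝ) (1 / 4)) (hs : ‖s‖ = 1) (hs1 : s ≠ 1)
    (h : IsDouble t s μ a b) (h' : IsDouble t s μ' a' b') {a₀ b₀ : ℂ → ℂ}
    (h₀ : IsSimple t s κ a₀ b₀) {x y : ℂ} (hxy : OnCurve t x y) :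
    sectionVal a b x y = sectionVal a' b' x y + (μ - μ') * sectionVal a₀ b₀ x y := by
  obtain ⟨a₃, b₃, ha, hb, e⟩ := h.expand
  obtain ⟨a₃', b₃', ha', hb', e'⟩ := h'.expand
  obtain ⟨a₂, b₂, ha₀, hb₀, e₀⟩ := h₀.expand
  have := ((h.sect.sub h'.sect).sub (h₀.sect.const_mul (μ - μ'))).sub_eq_const ht hs
    (A := fun x => a₃ x - a₃' x - (μ - μ') * (κ + x * a₂ x))
    (B := fun x => b₃ x - b₃' x - (μ - μ') * (((t : ℂ)⁻¹ + κ * (1 - s⁻¹)) + x * b₂ x))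
    (by repeat' first | assumption | exact DiskAlg.const _ | exact DiskAlg.id |
          apply DiskAlg.mul | apply DiskAlg.add | apply DiskAlg.sub)
    (by repeat' first | assumption | exact DiskAlg.const _ | exact DiskAlg.id |
          apply DiskAlg.mul | apply DiskAlg.add | apply DiskAlg.sub)
    (fun x hx0 hx => by
      rw [(e x hx0 hx).1, (e x hx0 hx).2, (e' x hx0 hx).1, (e' x hx0 hx).2, (e₀ x hx0 hx).1,
        (e₀ x hx0 hx).2]
      constructor <;> ring) x y hxy
  have h0 := (mul_left_eq_self₀.1 this.2).resolve_left hs1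
  rw [h0] at this
  have h1 := this.1
  simp only [sectionVal] at h1 ⊢
  linear_combination h1

theorem IsDouble.sub_eq_const (ht : t ∈ Ioo (0 : ℝ) (1 / 4))
    (h : IsDouble t 1 μ a b) (h' : IsDouble t 1 μ a' b') :
    ∃ c : ℂ, ∀ x y, OnCurve t x y → sectionVal a b x y = sectionVal a' b' x y + c := by
  obtain ⟨a₃, b₃, ha, hb, e⟩ := h.expand
  obtain ⟨a₃', b₃', ha', hb', e'⟩ := h'.expand
  have := (h.sect.sub h'.sect).sub_eq_const ht norm_one
    (A := fun x => a₃ x - a₃' x) (B := fun x => b₃ x - b₃' x) (ha.sub ha') (hb.sub hb')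
    (fun x hx0 hx => by
      rw [(e x hx0 hx).1, (e x hx0 hx).2, (e' x hx0 hx).1, (e' x hx0 hx).2]
      constructor <;> ring)
  refine ⟨a₃ 0 - a₃' 0, fun x y hxy => ?_⟩
  rw [← (this x y hxy).1]
  simp only [sectionVal]
  ring

theorem exists_pos_root {c : ℝ} (hc : 2 < c) : ∃ x : ℝ, 0 < x ∧ x < 1 ∧ x + x⁻¹ = c := by
  have h1 : 0 < c ^ 2 - 4 := by nlinarith
  have h2 := Real.sq_sqrt h1.le
  have h3 := Real.sqrt_pos.2 h1
  set d := √(c ^ 2 - 4)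
  have h4 : 0 < (c - d) / 2 := by nlinarith
  have h5 : (c - d) / 2 * ((c + d) / 2) = 1 := by nlinarith
  refine ⟨(c - d) / 2, h4, by nlinarith, ?_⟩
  rw [inv_eq_of_mul_eq_one_right h5]
  ring

theorem four_lt_inv (ht : t ∈ Ioo (0 : ℝ) (1 / 4)) : 4 < t⁻¹ := by
  rw [lt_inv_comm₀ (by norm_num) ht.1]
  linarith [ht.2]

theorem exists_diagonal_point (ht : t ∈ Ioo (0 : ℝ) (1 / 4)) :
    ∃ x : ℂ, OnCurve t x x ∧ x + x⁻¹ = (2 * t : ℂ)⁻¹ := by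
  obtain ⟨x, hx0, hx1, hx⟩ := exists_pos_root (c := t⁻¹ / 2) (by linarith [four_lt_inv ht])
  have hx' : (x : ℂ) + (x : ℂ)⁻¹ = (t : ℂ)⁻¹ / 2 := by exact_mod_cast congrArg ofReal hx
  have hn : ‖(x : ℂ)‖ ≤ 1 := by
    rw [norm_real, Real.norm_of_nonneg hx0.le]
    exact hx1.le
  refine ⟨x, ⟨ofReal_ne_zero.2 hx0.ne', ofReal_ne_zero.2 hx0.ne', hn, hn, ?_⟩, ?_⟩
  · linear_combination 2 * hx'
  · rw [hx', mul_inv]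
    ring

theorem exists_unit_point (ht : t ∈ Ioo (0 : ℝ) (1 / 4)) : ∃ y : ℂ, OnCurve t 1 y := by
  obtain ⟨x, hx0, hx1, hx⟩ := exists_pos_root (c := t⁻¹ - 2) (by linarith [four_lt_inv ht])
  have hx' : (x : ℂ) + (x : ℂ)⁻¹ = (t : ℂ)⁻¹ - 2 := by exact_mod_cast congrArg ofReal hx
  refine ⟨x, one_ne_zero, ofReal_ne_zero.2 hx0.ne', norm_one.le, ?_, ?_⟩
  · rw [norm_real, Real.norm_of_nonneg hx0.le]
    exact hx1.le
  · rw [inv_one]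
    linear_combination hx'

theorem IsSimple.unique (ht : t ∈ Ioo (0 : ℝ) (1 / 4)) (hs : ‖s‖ = 1) (hs1 : s ≠ 1)
    (h : IsSimple t s κ a b) (h' : IsSimple t s κ' a' b') : κ = κ' := by
  obtain ⟨a₂, b₂, ha, hb, e⟩ := h.expand
  obtain ⟨a₂', b₂', ha', hb', e'⟩ := h'.expand
  obtain ⟨x, hx, -⟩ := exists_diagonal_point ht
  have := (h.sect.sub h'.sect).sub_eq_const ht hs
    (A := fun x => κ - κ' + x * (a₂ x - a₂' x))
    (B := fun x => (κ - κ') * (1 - s⁻¹) + x * (b₂ x - b₂' x))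
    (by repeat' first | assumption | exact DiskAlg.const _ | exact DiskAlg.id |
          apply DiskAlg.mul | apply DiskAlg.add | apply DiskAlg.sub)
    (by repeat' first | assumption | exact DiskAlg.const _ | exact DiskAlg.id |
          apply DiskAlg.mul | apply DiskAlg.add | apply DiskAlg.sub)
    (fun x hx0 hx => by
      rw [(e x hx0 hx).1, (e x hx0 hx).2, (e' x hx0 hx).1, (e' x hx0 hx).2]
      constructor <;> ring) x x hx
  have h0 := (mul_left_eq_self₀.1 this.2).resolve_left hs1
  linear_combination h0

theorem IsSimple.flip (hs0 : s ≠ 0) (h : IsSimple t s κ a b) :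
    IsSimple t s⁻¹ (-(t : ℂ)⁻¹ - κ) (fun x => -s * (a x + b x * ((t : ℂ)⁻¹ - x - x⁻¹)))
      (fun x => -s * -b x) := by
  obtain ⟨a₂, b₂, ha, hb, e⟩ := h.expand
  refine ⟨(h.sect.flip hs0).const_mul _, ?_⟩
  generalize hβ : (t : ℂ)⁻¹ + κ * (1 - s⁻¹) = β at e
  refine ⟨fun x => -s * (a₂ x + β * (t : ℂ)⁻¹ - b₂ x - (1 + s⁻¹) - x * β - x * x * b₂ x +
    x * b₂ x * (t : ℂ)⁻¹), fun x => s * b₂ x, ?_, ?_, ?_⟩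
  · repeat' first | assumption | exact DiskAlg.const _ | exact DiskAlg.id | apply DiskAlg.mul |
      apply DiskAlg.add | apply DiskAlg.sub
  · exact (DiskAlg.const _).mul hb
  · intro x hx0 hx
    rw [(e x hx0 hx).1, (e x hx0 hx).2, ← hβ, inv_inv]
    constructor
    · field_simp
      ring
    · field_simp
      ring

theorem isSimple_neg_one (t : ℝ) :
    IsSimple t (-1) (-(2 * t : ℂ)⁻¹) (fun x => x + x⁻¹ - (2 * t : ℂ)⁻¹) fun _ => 0 := by
  refine ⟨fun x y hx0 hy0 hx hy hxy => ?_, fun _ => 1, fun _ => 0, DiskAlg.const _,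
    DiskAlg.const _, fun x hx0 hx => ⟨by ring, ?_⟩⟩
  · rw [mul_inv]
    linear_combination -hxy
  · rw [mul_inv, show (-1 : ℂ)⁻¹ = -1 by norm_num]
    ring

theorem isDouble_neg_one (t : ℝ) :
    IsDouble t (-1) (-(t : ℂ)⁻¹) (fun x => (x - x⁻¹) * ((t : ℂ)⁻¹ - x - x⁻¹))
      fun x => -2 * (x - x⁻¹) := by
  refine ⟨fun x y hx0 hy0 hx hy hxy => ?_, fun x => (t : ℂ)⁻¹ * x - x * x, fun _ => -2, ?_,
    DiskAlg.const _, fun x hx0 hx => ⟨?_, ?_⟩⟩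
  · rw [← hxy]
    ring
  · repeat' first | assumption | exact DiskAlg.const _ | exact DiskAlg.id | apply DiskAlg.mul |
      apply DiskAlg.add | apply DiskAlg.sub
  · linear_combination ((t : ℂ)⁻¹ * 0) * (mul_inv_cancel₀ hx0)
  · rw [show (-1 : ℂ)⁻¹ = -1 by norm_num]
    ring

/-- The algebraic relations between the values of the simple sections at the fixed point of the
order-four automorphism. -/
structure SectionRelations (t : ℝ) (k g : ℂ → ℂ) : Prop where
  inv : ∀ s, ‖s‖ = 1 → s ≠ 1 → k s⁻¹ = -k s
  mul : ∀ s r, ‖s‖ = 1 → ‖r‖ = 1 → s ≠ 1 → r ≠ 1 → s * r ≠ 1 → -(s * r) ≠ 1 →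
    g s * g r = (k s + k r - k (-(s * r))) * g (s * r)
  mul_neg_inv : ∀ s, ‖s‖ = 1 → s ≠ 1 → -s ≠ 1 → g s * g (-s⁻¹) = (2 * t : ℂ)⁻¹ ^ 2 - 4
  add : ∀ s, ‖s‖ = 1 → s ≠ 1 → -s ≠ 1 →
    -(g s * g s⁻¹) - g (-s) * g (-s⁻¹) = (k s - k (-s)) ^ 2 + 2 * (2 * t : ℂ)⁻¹ ^ 2 + 8

theorem exists_sectionRelations (ht : t ∈ Ioo (0 : ℝ) (1 / 4))
    (H : ∀ s : ℂ, ‖s‖ = 1 → s ≠ 1 → ∃ κ a b, IsSimple t s κ a b) :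
    ∃ k g : ℂ → ℂ, SectionRelations t k g ∧ ∀ s κ a b, ‖s‖ = 1 → s ≠ 1 →
      IsSimple t s κ a b → k s = κ + (2 * t : ℂ)⁻¹ := by
  have H' : ∀ s : ℂ, ∃ κ a b, ‖s‖ = 1 → s ≠ 1 → IsSimple t s κ a b := by
    intro s
    by_cases h : ‖s‖ = 1 ∧ s ≠ 1
    · obtain ⟨κ, a, b, h'⟩ := H s h.1 h.2
      exact ⟨κ, a, b, fun _ _ => h'⟩
    · exact ⟨0, 0, 0, fun h1 h2 => absurd ⟨h1, h2⟩ h⟩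
  choose κ a b hφ using H'
  obtain ⟨z, hz, hzw⟩ := exists_diagonal_point ht
  obtain ⟨y, hy⟩ := exists_unit_point ht
  set w : ℂ := (2 * t : ℂ)⁻¹ with hw
  have ht2 : (t : ℂ)⁻¹ = 2 * w := by
    rw [hw]
    field_simp
  have hw2 : w ≠ 2 := by
    intro h
    have h1 : ((t⁻¹ : ℝ) : ℂ) = ((4 : ℝ) : ℂ) := by
      push_cast
      rw [ht2, h]
      norm_num
    exact (four_lt_inv ht).ne' (ofReal_injective h1)
  have norm_ne : ∀ s : ℂ, ‖s‖ = 1 → s ≠ 0 := fun s hs =>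
    norm_pos_iff.1 (by rw [hs]; exact one_pos)
  have hκ : ∀ s κ' a' b', ‖s‖ = 1 → s ≠ 1 → IsSimple t s κ' a' b' → κ s = κ' :=
    fun s κ' a' b' hs hs1 h => (hφ s hs hs1).unique ht hs hs1 h
  have hinv : ∀ s : ℂ, ‖s‖ = 1 → s ≠ 1 → κ s⁻¹ = -(t : ℂ)⁻¹ - κ s := fun s hs hs1 =>
    hκ _ _ _ _ (by rw [norm_inv, hs, inv_one]) (inv_ne_one.2 hs1)
      ((hφ s hs hs1).flip (norm_ne s hs))
  have neg_inv_ne : ∀ s : ℂ, -s ≠ 1 → -s⁻¹ ≠ 1 := by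
    intro s h h'
    apply h
    rw [← inv_neg] at h'
    exact inv_eq_one.1 h'
  have inv_ne : ∀ s : ℂ, s ≠ 1 → s⁻¹ ≠ 1 := fun s h => inv_ne_one.2 h
  have hphi : ∀ u v, sectionVal (fun x => x + x⁻¹ - w) (fun _ => 0) u v = u + u⁻¹ - w := by
    intro u v
    simp [sectionVal]
  have hpsi : ∀ u v, OnCurve t u v → sectionVal (fun x => (x - x⁻¹) * ((t : ℂ)⁻¹ - x - x⁻¹))
      (fun x => -2 * (x - x⁻¹)) u v = (u - u⁻¹) * (v - v⁻¹) := by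
    intro u v h
    simp only [sectionVal]
    linear_combination -(u - u⁻¹) * h.eq
  have hmulni : ∀ s : ℂ, ‖s‖ = 1 → s ≠ 1 → -s ≠ 1 → ∀ u v, OnCurve t u v →
      sectionVal (a s) (b s) u v * sectionVal (a (-s⁻¹)) (b (-s⁻¹)) u v =
        (u - u⁻¹) * (v - v⁻¹) + (κ s - κ (-s)) * (u + u⁻¹ - w) := by
    intro s hs hs1 hs2 u v huv
    have hs' : ‖-s⁻¹‖ = 1 := by rw [norm_neg, norm_inv, hs, inv_one]
    have h1 := (hφ s hs hs1).mul (hφ (-s⁻¹) hs' (neg_inv_ne s hs2))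
    rw [mul_neg, mul_inv_cancel₀ (norm_ne s hs)] at h1
    have h2 := h1.sub_eq ht (by simp) (by norm_num) (isDouble_neg_one t) (isSimple_neg_one t) huv
    rw [sectionVal_mul huv, hpsi u v huv, hphi] at h2
    have h3 := hinv (-s) (by rwa [norm_neg]) hs2
    rw [inv_neg] at h3
    rw [h2, h3]
    ring
  have hmulinv : ∀ s : ℂ, ‖s‖ = 1 → s ≠ 1 → ∃ c : ℂ, ∀ u v, OnCurve t u v →
      sectionVal (a s) (b s) u v * sectionVal (a s⁻¹) (b s⁻¹) u v = (u + u⁻¹ - w) ^ 2 + c := by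
    intro s hs hs1
    have hs' : ‖s⁻¹‖ = 1 := by rw [norm_inv, hs, inv_one]
    have h1 := (hφ s hs hs1).mul (hφ s⁻¹ hs' (inv_ne s hs1))
    rw [mul_inv_cancel₀ (norm_ne s hs), hinv s hs hs1] at h1
    have h2 := (isSimple_neg_one t).mul (isSimple_neg_one t)
    rw [show (-1 : ℂ) * -1 = 1 by norm_num] at h2
    rw [show κ s + (-(t : ℂ)⁻¹ - κ s) = -(2 * t : ℂ)⁻¹ + -(2 * t : ℂ)⁻¹ by
      rw [← hw, ht2]; ring] at h1
    obtain ⟨c, hc⟩ := h1.sub_eq_const ht h2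
    refine ⟨c, fun u v huv => ?_⟩
    have h3 := hc u v huv
    rw [sectionVal_mul huv, sectionVal_mul huv, hphi] at h3
    rw [h3, sq]
  refine ⟨fun s => κ s + w, fun s => sectionVal (a s) (b s) z z, ⟨?_, ?_, ?_, ?_⟩, ?_⟩
  · intro s hs hs1
    rw [hinv s hs hs1, ht2]
    ring
  · intro s r hs hr hs1 hr1 hsr hsr'
    have hn : ‖s * r‖ = 1 := by rw [norm_mul, hs, hr, one_mul]
    have h1 := (hφ s hs hs1).mul (hφ r hr hr1)
    have h2 := (hφ (-(s * r)) (by rwa [norm_neg]) hsr').mul (isSimple_neg_one t)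
    rw [show -(s * r) * -1 = s * r by ring] at h2
    have h3 := h1.sub_eq ht hn hsr h2 (hφ _ hn hsr) hz
    rw [sectionVal_mul hz, sectionVal_mul hz, hphi, hzw] at h3
    rw [h3]
    ring
  · intro s hs hs1 hs2
    rw [hmulni s hs hs1 hs2 z z hz, hzw, ← hw, ← hzw]
    linear_combination (-4 : ℂ) * (mul_inv_cancel₀ hz.fst_ne)
  · intro s hs hs1 hs2
    have hns : ‖-s‖ = 1 := by rwa [norm_neg]
    have hs1' : -(-s) ≠ 1 := by rwa [neg_neg]
    obtain ⟨c, hc⟩ := hmulinv s hs hs1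
    obtain ⟨c', hc'⟩ := hmulinv (-s) hns hs2
    have e1 := hmulni s hs hs1 hs2
    have e2 := hmulni (-s) hns hs2 hs1'
    have z1 := hc z z hz
    have z2 := hc' z z hz
    have z3 := e1 z z hz
    have z4 := e2 z z hz
    have y1 := hc 1 y hy
    have y2 := hc' 1 y hy
    have y3 := e1 1 y hy
    have y4 := e2 1 y hy
    rw [hzw, sub_self] at z1 z2 z3 z4
    simp only [inv_neg, neg_neg] at z2 z4 y2 y4
    have hzz : (z - z⁻¹) * (z - z⁻¹) = w ^ 2 - 4 := by
      rw [← hzw]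
      linear_combination (-4 : ℂ) * (mul_inv_cancel₀ hz.fst_ne)
    rw [hzz] at z3 z4
    rw [inv_one, sub_self, zero_mul, zero_add] at y3 y4
    rw [inv_one] at y1 y2
    rw [z1, z2]
    set D := κ s - κ (-s) with hD
    have hD' : κ (-s) - κ s = -D := by rw [hD]; ring
    rw [hD'] at y4 z4
    have P1 : ((2 - w) ^ 2 + c) * ((2 - w) ^ 2 + c') = -D ^ 2 * (2 - w) ^ 2 := by
      rw [show (2 : ℂ) - w = 1 + 1 - w by norm_num, ← y1, ← y2]
      linear_combination (sectionVal (a (-s)) (b (-s)) 1 y * sectionVal (a s⁻¹) (b s⁻¹) 1 y) * y3 +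
        (D * (1 + 1 - w)) * y4
    have P2 : c * c' = (w ^ 2 - 4) ^ 2 := by
      have : c * c' = (0 ^ 2 + c) * (0 ^ 2 + c') := by ring
      rw [this, ← z1, ← z2]
      linear_combination (sectionVal (a (-s)) (b (-s)) z z * sectionVal (a s⁻¹) (b s⁻¹) z z) * z3 +
        (w ^ 2 - 4) * z4
    have hne : (2 - w) ^ 2 ≠ 0 := pow_ne_zero _ (sub_ne_zero.2 hw2.symm)
    refine mul_left_cancel₀ hne ?_
    have hk : κ s + w - (κ (-s) + w) = D := by rw [hD]; ring
    rw [hk]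
    linear_combination -P1 + P2
  · intro s κ' a' b' hs hs1 h
    exact congrArg (· + w) (hκ s κ' a' b' hs hs1 h)

end

/-- The four diagonal unit steps. -/
def diagSteps : Finset (ℤ × ℤ) := {(1, 1), (1, -1), (-1, -1), (-1, 1)}

theorem mem_diagSteps {p : ℤ × ℤ} :
    p ∈ diagSteps ↔ p = (1, 1) ∨ p = (1, -1) ∨ p = (-1, -1) ∨ p = (-1, 1) := by
  simp [diagSteps]

theorem zero_notMem_diagSteps : (0 : ℤ × ℤ) ∉ diagSteps := by decide

theorem isDiagStep_iff {p q : ℤ × ℤ} : IsDiagStep p q ↔ q - p ∈ diagSteps := by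
  rw [mem_diagSteps, IsDiagStep]

theorem neg_mem_diagSteps {p : ℤ × ℤ} : -p ∈ diagSteps ↔ p ∈ diagSteps := by
  obtain ⟨x, y⟩ := p
  simp only [mem_diagSteps, Prod.neg_mk, Prod.mk.injEq]
  omega

/-- Walks from `p` to the origin of length `m + 1` with nonzero intermediate points. -/
def walksTo : ℕ → ℤ × ℤ → Finset (List (ℤ × ℤ))
  | 0, p => if p ∈ diagSteps then {[p, 0]} else ∅
  | m + 1, p => diagSteps.biUnion fun d =>
      if p + d = 0 then ∅ else (walksTo m (p + d)).image (p :: ·)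

/-- The sum of `e^{ibθ}` over `walksTo m p`, defined by its first-step recursion. -/
def walkSum (b : ℝ) : ℕ → ℤ × ℤ → ℂ
  | 0, p => if p ∈ diagSteps then 1 else 0
  | m + 1, p => ∑ d ∈ diagSteps, if p + d = 0 then 0 else
      cexp (I * b * (ptC (p + d) / ptC p).arg) * walkSum b m (p + d)

theorem mem_walksTo {m : ℕ} {p : ℤ × ℤ} {l : List (ℤ × ℤ)} :
    l ∈ walksTo m p ↔ l.length = m + 2 ∧ l.head? = some p ∧ l.IsChain IsDiagStep ∧
      l.getLast? = some 0 ∧ ∀ i, 1 ≤ i → i ≤ m → l.getD i 0 ≠ 0 := by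
  induction m generalizing p l with
  | zero =>
    rw [walksTo]
    constructor
    · split_ifs with hp
      · rintro h
        obtain rfl := Finset.mem_singleton.1 h
        refine ⟨rfl, rfl, ?_, rfl, fun i h1 h2 => by omega⟩
        simpa [isDiagStep_iff, neg_mem_diagSteps] using hp
      · simp
    · rintro ⟨h1, h2, h3, h4, -⟩
      match l, h1 with
      | [q, r], _ =>
        simp only [List.head?_cons, Option.some.injEq] at h2
        simp at h4
        subst h2 h4
        simp only [List.isChain_cons_cons, isDiagStep_iff, zero_sub, neg_mem_diagSteps] at h3
        simp [h3.1]
  | succ m ih =>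
    rw [walksTo]
    simp only [Finset.mem_biUnion]
    constructor
    · rintro ⟨d, hd, h⟩
      split_ifs at h with h0
      · simp at h
      · obtain ⟨l', hl', rfl⟩ := Finset.mem_image.1 h
        obtain ⟨h1, h2, h3, h4, h5⟩ := ih.1 hl'
        match l', h2 with
        | q :: l'', h2 =>
          simp only [List.head?_cons, Option.some.injEq] at h2
          subst h2
          refine ⟨by simp at h1 ⊢; omega, rfl, ?_, by simpa using h4, ?_⟩
          · rw [List.isChain_cons_cons]
            exact ⟨isDiagStep_iff.2 (by simpa using hd), h3⟩
          · intro i hi1 hi2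
            match i with
            | 1 => simpa using h0
            | i + 2 => simpa using h5 (i + 1) (by omega) (by omega)
    · rintro ⟨h1, h2, h3, h4, h5⟩
      match l, h1 with
      | p' :: q :: l'', h1 =>
        simp only [List.head?_cons, Option.some.injEq] at h2
        subst h2
        rw [List.isChain_cons_cons, isDiagStep_iff] at h3
        have hq : q ≠ 0 := by simpa using h5 1 le_rfl (by omega)
        refine ⟨q - p', h3.1, ?_⟩
        rw [add_sub_cancel, if_neg hq]
        refine Finset.mem_image.2 ⟨q :: l'', ih.2 ⟨?_, rfl, h3.2, by simpa using h4, ?_⟩, rfl⟩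
        · simp at h1 ⊢; omega
        · intro i hi1 hi2
          simpa using h5 (i + 1) (by omega) (by omega)

/-- The winding angle of a list of points, ignoring the last step. -/
def windInit (l : List (ℤ × ℤ)) : ℝ :=
  ∑ k ∈ Finset.range (l.length - 2), (ptC (l.getD (k + 1) 0) / ptC (l.getD k 0)).arg

theorem windInit_cons (p q : ℤ × ℤ) (l : List (ℤ × ℤ)) (hl : l ≠ []) :
    windInit (p :: q :: l) = (ptC q / ptC p).arg + windInit (q :: l) := by
  have : (p :: q :: l).length - 2 = (q :: l).length - 2 + 1 := by
    have := List.length_pos_of_ne_nil hl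
    simp; omega
  rw [windInit, this, Finset.sum_range_succ', add_comm, windInit]
  simp

theorem windExc_cons (l : List (ℤ × ℤ)) : windExc (0 :: l) = windInit l := by
  rw [windExc, windExcTo, windInit]
  have : min ((0 :: l).length - 1) ((0 :: l).length - 2) = (l.length - 2) + 1 ∨ l.length ≤ 1 := by
    simp; omega
  rcases this with h | h
  · rw [h]
    refine (Finset.sum_bij (fun k _ => k + 2) ?_ ?_ ?_ ?_).symm
    · intro k hk
      rw [Finset.mem_range] at hk
      rw [Finset.mem_Icc]
      omega
    · intro k _ k2 _ h
      omega
    · intro j hj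
      rw [Finset.mem_Icc] at hj
      exact ⟨j - 2, Finset.mem_range.2 (by omega), by omega⟩
    · intro k _
      simp
  · rw [Finset.Icc_eq_empty (by simp; omega), show l.length - 2 = 0 by omega]
    simp

theorem sum_walksTo (b : ℝ) (m : ℕ) (p : ℤ × ℤ) :
    ∑ l ∈ walksTo m p, cexp (I * b * windInit l) = walkSum b m p := by
  induction m generalizing p with
  | zero =>
    rw [walksTo, walkSum]
    split_ifs <;> simp [windInit]
  | succ m ih =>
    rw [walksTo, walkSum, Finset.sum_biUnion]
    · refine Finset.sum_congr rfl fun d _ => ?_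
      split_ifs with h0
      · simp
      · rw [Finset.sum_image (fun a _ b _ hab => by simpa using hab), ← ih, Finset.mul_sum]
        refine Finset.sum_congr rfl fun l hl => ?_
        obtain ⟨h1, h2, -⟩ := mem_walksTo.1 hl
        match l, h1 with
        | q :: r :: l', h1 =>
          simp only [List.head?_cons, Option.some.injEq] at h2
          subst h2
          rw [windInit_cons _ _ _ (by simp), ← Complex.exp_add]
          push_cast
          ring_nf
    · intro d _ e _ hde
      rw [Function.onFun, Finset.disjoint_left]
      intro l hl hl'
      split_ifs at hl hl' with h1 h2 <;> try simp only [Finset.notMem_empty] at hl hl'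
      obtain ⟨l1, hl1, rfl⟩ := Finset.mem_image.1 hl
      obtain ⟨l2, hl2, h⟩ := Finset.mem_image.1 hl'
      obtain rfl : l2 = l1 := by simpa using h
      have := (mem_walksTo.1 hl1).2.1.symm.trans (mem_walksTo.1 hl2).2.1
      exact hde (by simpa using this)

/-- Excursions of length `m + 2`. -/
def excursions (m : ℕ) : Finset (List (ℤ × ℤ)) :=
  (diagSteps.biUnion (walksTo m)).image ((0 : ℤ × ℤ) :: ·)

theorem isExcursion_of_mem {m : ℕ} {w : List (ℤ × ℤ)} (h : w ∈ excursions m) :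
    IsExcursion w ∧ w.length = m + 3 := by
  simp only [excursions, Finset.mem_image, Finset.mem_biUnion] at h
  obtain ⟨l, ⟨p, hp, hl⟩, rfl⟩ := h
  obtain ⟨h1, h2, h3, h4, h5⟩ := mem_walksTo.1 hl
  match l, h1 with
  | q :: r :: l', h1 =>
    simp only [List.head?_cons, Option.some.injEq] at h2
    subst h2
    refine ⟨⟨by simp, List.isChain_cons_cons.2 ⟨isDiagStep_iff.2 (by simpa using hp), h3⟩, rfl, ?_,
        ?_⟩,
      by simp at h1 ⊢; omega⟩
    · rw [List.getLast?_cons_cons]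
      exact h4
    · intro i hi1 hi2
      match i with
      | 1 =>
        rintro h
        have hq : q = 0 := h
        exact zero_notMem_diagSteps (hq ▸ hp)
      | i + 2 => exact h5 (i + 1) (by omega) (by simp at h1 hi2; omega)

theorem IsExcursion.mem {w : List (ℤ × ℤ)} (h : IsExcursion w) :
    ∃ m, w ∈ excursions m := by
  obtain ⟨h1, h2, h3, h4, h5⟩ := h
  match w, h1 with
  | [p, q], _ =>
    simp only [List.head?_cons, Option.some.injEq] at h3
    simp at h4
    subst h3 h4
    exact absurd (isDiagStep_iff.1 (List.isChain_cons_cons.1 h2).1) zero_notMem_diagSteps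
  | p :: q :: r :: l, _ =>
    simp only [List.head?_cons, Option.some.injEq] at h3
    subst h3
    have h2' := List.isChain_cons_cons.1 h2
    refine ⟨l.length, ?_⟩
    rw [excursions, Finset.mem_image]
    refine ⟨q :: r :: l, Finset.mem_biUnion.2 ⟨q, ?_, mem_walksTo.2 ⟨by simp, rfl, h2'.2, ?_, ?_⟩⟩,
        rfl⟩
    · have := isDiagStep_iff.1 h2'.1
      rwa [Prod.mk_zero_zero, sub_zero] at this
    · rw [List.getLast?_cons_cons] at h4
      exact h4
    · intro i hi1 hi2
      exact h5 (i + 1) (by omega) (by simp; omega)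

/-- Excursions are the walks in `excursions m` for varying `m`. -/
def sigmaEquivExcursion : (Σ m, excursions m) ≃ {w : List (ℤ × ℤ) // IsExcursion w} :=
  Equiv.ofBijective (fun w => ⟨w.2.1, (isExcursion_of_mem w.2.2).1⟩) <| by
    constructor
    · rintro ⟨m, w, h⟩ ⟨m', w', h'⟩ e
      obtain rfl : w = w' := congrArg Subtype.val e
      have h1 := (isExcursion_of_mem h).2
      have h2 := (isExcursion_of_mem h').2
      obtain rfl : m = m' := by omega
      rfl
    · rintro ⟨w, hw⟩
      obtain ⟨m, hm⟩ := hw.mem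
      exact ⟨⟨m, w, hm⟩, rfl⟩

theorem card_walksTo_le (m : ℕ) (p : ℤ × ℤ) : (walksTo m p).card ≤ 4 ^ m := by
  induction m generalizing p with
  | zero => rw [walksTo]; split_ifs <;> simp
  | succ m ih =>
    rw [walksTo, pow_succ, mul_comm]
    refine (Finset.card_biUnion_le_card_mul _ _ (4 ^ m) fun d _ => ?_).trans ?_
    · split_ifs
      · simp
      · exact Finset.card_image_le.trans (ih _)
    · exact Nat.mul_le_mul_right _ (by decide)

theorem card_excursions_le (m : ℕ) : (excursions m).card ≤ 4 * 4 ^ m :=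
  Finset.card_image_le.trans <|
    (Finset.card_biUnion_le_card_mul _ _ (4 ^ m) fun d _ => card_walksTo_le m d).trans <|
      Nat.mul_le_mul_right _ (by decide)

theorem sum_excursions (b : ℝ) (m : ℕ) :
    ∑ w ∈ excursions m, cexp (I * b * windExc w) = ∑ p ∈ diagSteps, walkSum b m p := by
  rw [excursions, Finset.sum_image (fun a _ b _ hab => by simpa using hab), Finset.sum_biUnion]
  · simp_rw [windExc_cons, sum_walksTo]
  · intro d _ e _ hde
    rw [Function.onFun, Finset.disjoint_left]
    intro l hl hl'
    have := (mem_walksTo.1 hl).2.1.symm.trans (mem_walksTo.1 hl').2.1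
    exact hde (by simpa using this)

theorem norm_exp_I_mul (b θ : ℝ) : ‖cexp (I * b * θ)‖ = 1 := by
  rw [show I * (b : ℂ) * θ = ((b * θ : ℝ) : ℂ) * I by push_cast; ring]
  exact norm_exp_ofReal_mul_I _

theorem Fchar_eq_tsum {t : ℝ} (ht : t ∈ Ioo (0 : ℝ) (1 / 4)) (b : ℝ) :
    Fchar t b = ∑' m : ℕ, (t : ℂ) ^ (m + 2) * ∑ p ∈ diagSteps, walkSum b m p := by
  have hinner : ∀ m : ℕ, ∀ w : excursions m,
      (t : ℂ) ^ (w.1.length - 1) * cexp (I * b * windExc w.1) =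
        (t : ℂ) ^ (m + 2) * cexp (I * b * windExc w.1) := by
    intro m w
    rw [(isExcursion_of_mem w.2).2]
    rfl
  have hs : Summable fun w : (Σ m, excursions m) =>
      (t : ℂ) ^ (w.2.1.length - 1) * cexp (I * b * windExc w.2.1) := by
    apply Summable.of_norm
    refine (summable_sigma_of_nonneg fun _ => norm_nonneg _).2 ⟨fun m => Summable.of_finite, ?_⟩
    have hg : Summable fun m : ℕ => 4 * t ^ 2 * (4 * t) ^ m :=
      (summable_geometric_of_lt_one (by linarith [ht.1]) (by linarith [ht.2])).mul_left _
    refine Summable.of_nonneg_of_le (fun m => tsum_nonneg fun _ => norm_nonneg _) (fun m => ?_) hg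
    simp_rw [hinner, norm_mul, norm_exp_I_mul, norm_pow, mul_one]
    rw [tsum_fintype, Finset.sum_const, Finset.card_univ, Fintype.card_coe, nsmul_eq_mul,
      Complex.norm_real, Real.norm_of_nonneg ht.1.le]
    have hc : ((excursions m).card : ℝ) ≤ 4 * 4 ^ m := by exact_mod_cast card_excursions_le m
    calc ((excursions m).card : ℝ) * t ^ (m + 2) ≤ (4 * 4 ^ m) * t ^ (m + 2) :=
          mul_le_mul_of_nonneg_right hc (pow_nonneg ht.1.le _)
      _ = _ := by ring
  rw [Fchar, ← sigmaEquivExcursion.tsum_eq]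
  refine (hs.tsum_sigma' fun m => Summable.of_finite).trans (tsum_congr fun m => ?_)
  simp_rw [hinner]
  rw [tsum_fintype, ← Finset.mul_sum, ← sum_excursions]
  congr 1
  exact Finset.sum_coe_sort (excursions m) fun w => cexp (I * b * windExc w)

theorem norm_walkSum_le (b : ℝ) (m : ℕ) (p : ℤ × ℤ) : ‖walkSum b m p‖ ≤ 4 ^ m := by
  induction m generalizing p with
  | zero => rw [walkSum]; split_ifs <;> simp
  | succ m ih =>
    rw [walkSum]
    refine (norm_sum_le _ _).trans ((Finset.sum_le_card_nsmul _ _ (4 ^ m) fun d _ => ?_).trans ?_)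
    · split_ifs
      · simp
      · rw [norm_mul, norm_exp_I_mul, one_mul]
        exact ih _
    · rw [show diagSteps.card = 4 from rfl, nsmul_eq_mul, pow_succ]
      push_cast
      linarith

theorem walkSum_eq_zero (b : ℝ) {m : ℕ} {p : ℤ × ℤ} (h : (m : ℤ) + 1 < p.2) :
    walkSum b m p = 0 := by
  induction m generalizing p with
  | zero =>
    rw [walkSum, if_neg]
    intro hp
    rcases mem_diagSteps.1 hp with rfl | rfl | rfl | rfl <;> simp at h
  | succ m ih =>
    rw [walkSum]
    refine Finset.sum_eq_zero fun d hd => ?_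
    rw [ih, mul_zero, ite_self]
    have : -1 ≤ d.2 := by
      rcases mem_diagSteps.1 hd with rfl | rfl | rfl | rfl <;> simp
    rw [Prod.snd_add]
    push_cast at h
    omega

/-- Rotation of the lattice by a quarter turn. -/
def quarterTurn (p : ℤ × ℤ) : ℤ × ℤ := (-p.2, p.1)

theorem ptC_quarterTurn (p : ℤ × ℤ) : ptC (quarterTurn p) = I * ptC p := by
  simp only [ptC, quarterTurn]
  push_cast
  linear_combination (-(p.2 : ℂ)) * I_mul_I

theorem quarterTurn_mem_diagSteps {p : ℤ × ℤ} : quarterTurn p ∈ diagSteps ↔ p ∈ diagSteps := by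
  obtain ⟨x, y⟩ := p
  simp only [mem_diagSteps, quarterTurn, Prod.mk.injEq]
  omega

theorem quarterTurn_eq_zero {p : ℤ × ℤ} : quarterTurn p = 0 ↔ p = 0 := by
  obtain ⟨x, y⟩ := p
  simp only [quarterTurn, Prod.mk_eq_zero]
  omega

theorem quarterTurn_add (p q : ℤ × ℤ) :
    quarterTurn (p + q) = quarterTurn p + quarterTurn q := by
  simp [quarterTurn, add_comm]

theorem walkSum_quarterTurn (b : ℝ) (m : ℕ) (p : ℤ × ℤ) :
    walkSum b m (quarterTurn p) = walkSum b m p := by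
  induction m generalizing p with
  | zero => simp only [walkSum, quarterTurn_mem_diagSteps]
  | succ m ih =>
    simp only [walkSum]
    symm
    refine Finset.sum_bij (fun d _ => quarterTurn d) (fun d hd => quarterTurn_mem_diagSteps.2 hd)
      ?_ ?_ ?_
    · rintro ⟨x, y⟩ - ⟨x', y'⟩ - h
      simp only [quarterTurn, Prod.mk.injEq] at h ⊢
      omega
    · rintro ⟨x, y⟩ h
      refine ⟨(y, -x), ?_, by simp [quarterTurn]⟩
      rw [← quarterTurn_mem_diagSteps]
      simpa [quarterTurn] using h
    · intro d _
      simp only [← quarterTurn_add, quarterTurn_eq_zero, ih, ptC_quarterTurn]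
      rw [mul_div_mul_left _ _ I_ne_zero]

/-- Generating function of the walks from `p` to the origin. -/
def walkGen (t b : ℝ) (p : ℤ × ℤ) : ℂ := ∑' m : ℕ, (t : ℂ) ^ m * walkSum b m p

theorem walkGen_quarterTurn (t b : ℝ) (p : ℤ × ℤ) :
    walkGen t b (quarterTurn p) = walkGen t b p := by
  simp only [walkGen, walkSum_quarterTurn]

section

variable {t : ℝ} (ht : t ∈ Ioo (0 : ℝ) (1 / 4)) (b : ℝ)

include ht

theorem norm_walkGen_term_le (m : ℕ) (p : ℤ × ℤ) :
    ‖(t : ℂ) ^ m * walkSum b m p‖ ≤ (4 * t) ^ m := by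
  rw [norm_mul, norm_pow, Complex.norm_real, Real.norm_of_nonneg ht.1.le, mul_comm, mul_pow]
  exact mul_le_mul_of_nonneg_right (norm_walkSum_le b m p) (pow_nonneg ht.1.le _)

theorem summable_four_mul_pow : Summable fun m : ℕ => (4 * t) ^ m :=
  summable_geometric_of_lt_one (by linarith [ht.1]) (by linarith [ht.2])

theorem summable_walkGen (p : ℤ × ℤ) : Summable fun m : ℕ => (t : ℂ) ^ m * walkSum b m p :=
  (summable_four_mul_pow ht).of_norm_bounded fun m => norm_walkGen_term_le ht b m p

theorem norm_walkGen_le {n : ℕ} {p : ℤ × ℤ} (hp : p.2 = n + 1) :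
    ‖walkGen t b p‖ ≤ (1 - 4 * t)⁻¹ * (4 * t) ^ n := by
  rw [walkGen, ← (summable_walkGen ht b p).sum_add_tsum_nat_add n, Finset.sum_eq_zero, zero_add]
  · have hs : Summable fun m : ℕ => (4 * t) ^ n * (4 * t) ^ m :=
      (summable_four_mul_pow ht).mul_left _
    refine (tsum_of_norm_bounded hs.hasSum fun m => ?_).trans_eq ?_
    · rw [← pow_add, add_comm n]
      exact norm_walkGen_term_le ht b _ p
    · rw [tsum_mul_left, tsum_geometric_of_lt_one (by linarith [ht.1]) (by linarith [ht.2]),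
        mul_comm]
  · intro m hm
    rw [walkSum_eq_zero, mul_zero]
    have := Finset.mem_range.1 hm
    omega

theorem walkGen_eq (p : ℤ × ℤ) :
    walkGen t b p = (if p ∈ diagSteps then 1 else 0) + t * ∑ d ∈ diagSteps,
      if p + d = 0 then 0 else
        cexp (I * b * (ptC (p + d) / ptC p).arg) * walkGen t b (p + d) := by
  rw [walkGen, (summable_walkGen ht b p).tsum_eq_zero_add]
  congr 1
  · simp [walkSum]
  · simp_rw [walkSum, Finset.mul_sum]
    rw [Summable.tsum_finsetSum]
    · refine Finset.sum_congr rfl fun d _ => ?_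
      split_ifs
      · simp
      · rw [walkGen, ← tsum_mul_left, ← tsum_mul_left]
        refine tsum_congr fun m => ?_
        ring
    · intro d _
      split_ifs
      · simp
      · refine ((summable_walkGen ht b (p + d)).mul_left
          (t * cexp (I * b * (ptC (p + d) / ptC p).arg))).congr fun m => ?_
        ring

theorem Fchar_eq_walkGen : Fchar t b = 4 * t ^ 2 * walkGen t b (1, 1) := by
  have h1 : ∀ m p, p ∈ diagSteps → walkSum b m p = walkSum b m (1, 1) := by
    intro m p hp
    have e1 := walkSum_quarterTurn b m (1, 1)
    have e2 := walkSum_quarterTurn b m (-1, 1)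
    have e3 := walkSum_quarterTurn b m (-1, -1)
    simp only [quarterTurn] at e1 e2 e3
    norm_num at e1 e2 e3
    rcases mem_diagSteps.1 hp with rfl | rfl | rfl | rfl
    · rfl
    · rw [e3, e2, e1]
    · rw [e2, e1]
    · rw [e1]
  rw [Fchar_eq_tsum ht, walkGen, ← tsum_mul_left]
  refine tsum_congr fun m => ?_
  rw [Finset.sum_congr rfl (h1 m), Finset.sum_const, show diagSteps.card = 4 from rfl, nsmul_eq_mul]
  push_cast
  ring

end

theorem arg_div_of_quadrant {z w : ℂ} (hz : z ≠ 0) (hw : w ≠ 0) (hz1 : 0 ≤ z.re) (hz2 : 0 ≤ z.im)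
    (hw1 : 0 ≤ w.re) (hw2 : 0 ≤ w.im) : (w / z).arg = w.arg - z.arg := by
  have a1 := (abs_le.1 (abs_arg_le_pi_div_two_iff.2 hz1)).2
  have a2 := (abs_le.1 (abs_arg_le_pi_div_two_iff.2 hw1)).2
  have a3 := arg_nonneg_iff.2 hz2
  have a4 := arg_nonneg_iff.2 hw2
  have hpi := Real.pi_pos
  have hinv : z⁻¹.arg = -z.arg := by
    rw [arg_inv, if_neg (by linarith)]
  rw [div_eq_mul_inv, arg_mul hw (inv_ne_zero hz), hinv]
  · ring
  · rw [hinv]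
    constructor <;> linarith

/-- Points of the first quadrant, with first coordinate shifted by one. -/
def quadPt (i j : ℕ) : ℂ := ((i + 1 : ℝ) : ℂ) + ((j : ℝ) : ℂ) * I

theorem quadPt_re (i j : ℕ) : (quadPt i j).re = i + 1 := by simp [quadPt]
theorem quadPt_im (i j : ℕ) : (quadPt i j).im = j := by simp [quadPt]

theorem quadPt_ne_zero (i j : ℕ) : quadPt i j ≠ 0 := by
  intro h
  have := quadPt_re i j
  rw [h] at this
  simp only [Complex.zero_re] at this
  linarith [(Nat.cast_nonneg i : (0 : ℝ) ≤ i)]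

/-- Generating function of the walks started from the first quadrant (in coordinates rotated by an
eighth of a turn), weighted by the winding angle measured from the horizontal axis. -/
def quadGen (t b : ℝ) (i j : ℕ) : ℂ :=
  cexp (I * b * (quadPt i j).arg) * walkGen t b ((i : ℤ) + 1 - j, (i : ℤ) + 1 + j)

theorem ptC_quad (i j : ℕ) : ptC ((i : ℤ) + 1 - j, (i : ℤ) + 1 + j) = (1 + I) * quadPt i j := by
  simp only [ptC, quadPt]
  push_cast
  linear_combination (-(j : ℂ)) * I_mul_I

theorem one_add_I_ne_zero : (1 + I : ℂ) ≠ 0 := by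
  intro h
  have := congrArg Complex.re h
  simp at this

theorem norm_quadGen_le {t : ℝ} (ht : t ∈ Ioo (0 : ℝ) (1 / 4)) (b : ℝ) (i j : ℕ) :
    ‖quadGen t b i j‖ ≤ (1 - 4 * t)⁻¹ * (4 * t) ^ (i + j) := by
  rw [quadGen, norm_mul, norm_exp_I_mul, one_mul]
  exact norm_walkGen_le ht b (by push_cast; ring)

theorem quadPt_arg_zero (i : ℕ) : (quadPt i 0).arg = 0 := by
  rw [arg_eq_zero_iff, quadPt_re, quadPt_im]
  exact ⟨by positivity, by simp⟩

theorem exp_arg_quadPt_div (b : ℝ) (i j i' j' : ℕ) :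
    cexp (I * b * (quadPt i j).arg) * cexp (I * b * (quadPt i' j' / quadPt i j).arg) =
      cexp (I * b * (quadPt i' j').arg) := by
  rw [← Complex.exp_add, arg_div_of_quadrant (quadPt_ne_zero _ _) (quadPt_ne_zero _ _)]
  · push_cast
    ring_nf
  all_goals simp only [quadPt_re, quadPt_im]; positivity

/-- The phase picked up across a quarter turn. -/
def quarterPhase (b : ℝ) : ℂ := cexp (I * b * (-(π / 2) : ℝ))

theorem quarterPhase_inv (b : ℝ) : (quarterPhase b)⁻¹ = cexp (I * b * (π / 2 : ℝ)) := by
  rw [quarterPhase, ← Complex.exp_neg]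
  push_cast
  ring_nf

theorem quadPt_sub_I (i : ℕ) : ((quadPt i 0 - I) / quadPt i 0).arg =
    (quadPt 0 (i + 1)).arg - π / 2 - (quadPt i 0).arg := by
  have h1 : quadPt i 0 - I = -I * quadPt 0 (i + 1) := by
    simp only [quadPt]
    push_cast
    linear_combination (i + 1 : ℂ) * I_mul_I
  have h2 := arg_div_of_quadrant (quadPt_ne_zero i 0) (quadPt_ne_zero 0 (i + 1))
    (by rw [quadPt_re]; positivity) (by rw [quadPt_im]; positivity)
    (by rw [quadPt_re]; positivity) (by rw [quadPt_im]; positivity)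
  have a1 := (abs_le.1 (abs_arg_le_pi_div_two_iff.2
    (show 0 ≤ (quadPt 0 (i + 1)).re by rw [quadPt_re]; positivity))).2
  have a2 := arg_nonneg_iff.2 (show 0 ≤ (quadPt 0 (i + 1)).im by rw [quadPt_im]; positivity)
  have hpi := Real.pi_pos
  rw [h1, mul_div_assoc, arg_mul (neg_ne_zero.2 I_ne_zero)
    (div_ne_zero (quadPt_ne_zero _ _) (quadPt_ne_zero _ _)), h2, arg_neg_I]
  · ring
  · rw [h2, arg_neg_I, quadPt_arg_zero]
    constructor <;> linarith

theorem quadPt_sub_one (j : ℕ) : ((quadPt 0 (j + 1) - 1) / quadPt 0 (j + 1)).arg =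
    π / 2 - (quadPt 0 (j + 1)).arg := by
  have h1 : quadPt 0 (j + 1) - 1 = ((j + 1 : ℝ) : ℂ) * I := by
    simp [quadPt]
  have hpos : (0 : ℝ) < j + 1 := by positivity
  rw [h1, arg_div_of_quadrant (quadPt_ne_zero _ _), Complex.arg_real_mul _ hpos, arg_I]
  · exact mul_ne_zero (by exact_mod_cast hpos.ne') I_ne_zero
  · rw [quadPt_re]; positivity
  · rw [quadPt_im]; positivity
  · simp
  · simpa using hpos.le

theorem quadGen_eq {t : ℝ} (ht : t ∈ Ioo (0 : ℝ) (1 / 4)) (b : ℝ) (i j : ℕ) :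
    quadGen t b i j = (if i = 0 ∧ j = 0 then 1 else 0) + t * (quadGen t b (i + 1) j +
      (if i = 0 then if j = 0 then 0 else (quarterPhase b)⁻¹ * quadGen t b (j - 1) 0
        else quadGen t b (i - 1) j) + quadGen t b i (j + 1) +
      if j = 0 then quarterPhase b * quadGen t b 0 (i + 1) else quadGen t b i (j - 1)) := by
  have key : quadGen t b i j = (if ((i : ℤ) + 1 - j, (i : ℤ) + 1 + j) ∈ diagSteps then 1 else 0) *
      cexp (I * b * (quadPt i j).arg) + t * ∑ d ∈ diagSteps,
        if ((i : ℤ) + 1 - j, (i : ℤ) + 1 + j) + d = 0 then 0 else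
        cexp (I * b * (quadPt i j).arg) *
          (cexp (I * b * (ptC (((i : ℤ) + 1 - j, (i : ℤ) + 1 + j) + d) /
            ptC ((i : ℤ) + 1 - j, (i : ℤ) + 1 + j)).arg) *
          walkGen t b (((i : ℤ) + 1 - j, (i : ℤ) + 1 + j) + d)) := by
    rw [quadGen, walkGen_eq ht b, mul_add, mul_comm (cexp _) (ite _ _ _), mul_left_comm (cexp _),
      Finset.mul_sum]
    simp only [mul_ite, mul_zero]
  rw [key]
  congr 1
  · by_cases h : i = 0 ∧ j = 0
    · obtain ⟨rfl, rfl⟩ := h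
      rw [quadPt_arg_zero]
      simp [mem_diagSteps]
    · rw [if_neg h, if_neg, zero_mul]
      simp only [mem_diagSteps, Prod.mk.injEq]
      omega
  · congr 1
    rw [diagSteps, Finset.sum_insert (by decide), Finset.sum_insert (by decide),
      Finset.sum_insert (by decide), Finset.sum_singleton]
    have e1 : ((i : ℤ) + 1 - j, (i : ℤ) + 1 + j) + (1, 1) =
        (((i + 1 : ℕ) : ℤ) + 1 - j, ((i + 1 : ℕ) : ℤ) + 1 + j) := by
      simp only [Prod.mk_add_mk, Prod.mk.injEq]; push_cast; omega
    have e4 : ((i : ℤ) + 1 - j, (i : ℤ) + 1 + j) + (-1, 1) =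
        ((i : ℤ) + 1 - ((j + 1 : ℕ) : ℤ), (i : ℤ) + 1 + ((j + 1 : ℕ) : ℤ)) := by
      simp only [Prod.mk_add_mk, Prod.mk.injEq]; push_cast; omega
    have move : ∀ i' j' : ℕ, (if ((i' : ℤ) + 1 - j', (i' : ℤ) + 1 + j') = 0 then 0 else
        cexp (I * b * (quadPt i j).arg) *
          (cexp (I * b * (ptC ((i' : ℤ) + 1 - j', (i' : ℤ) + 1 + j') /
            ptC ((i : ℤ) + 1 - j, (i : ℤ) + 1 + j)).arg) *
          walkGen t b ((i' : ℤ) + 1 - j', (i' : ℤ) + 1 + j'))) = quadGen t b i' j' := by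
      intro i' j'
      rw [if_neg (by simp only [Prod.mk_eq_zero]; omega), ptC_quad, ptC_quad,
        mul_div_mul_left _ _ one_add_I_ne_zero, ← mul_assoc, exp_arg_quadPt_div, quadGen]
    rw [e1, e4, move, move]
    have h2 : (if ((i : ℤ) + 1 - j, (i : ℤ) + 1 + j) + (1, -1) = 0 then 0 else
        cexp (I * b * (quadPt i j).arg) *
          (cexp (I * b * (ptC (((i : ℤ) + 1 - j, (i : ℤ) + 1 + j) + (1, -1)) /
            ptC ((i : ℤ) + 1 - j, (i : ℤ) + 1 + j)).arg) *
          walkGen t b (((i : ℤ) + 1 - j, (i : ℤ) + 1 + j) + (1, -1)))) =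
        if j = 0 then quarterPhase b * quadGen t b 0 (i + 1) else quadGen t b i (j - 1) := by
      rcases j with _ | j
      · have e : ((i : ℤ) + 1 - ((0 : ℕ) : ℤ), (i : ℤ) + 1 + ((0 : ℕ) : ℤ)) + (1, -1) =
            quarterTurn (quarterTurn (quarterTurn (((0 : ℕ) : ℤ) + 1 - ((i + 1 : ℕ) : ℤ),
                ((0 : ℕ) : ℤ) + 1 + ((i + 1 : ℕ) : ℤ)))) := by
          simp only [quarterTurn, Prod.mk_add_mk, Prod.mk.injEq]; push_cast; omega
        have e' : ptC (((i : ℤ) + 1 - ((0 : ℕ) : ℤ), (i : ℤ) + 1 + ((0 : ℕ) : ℤ)) + (1, -1)) =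
            (1 + I) * (quadPt i 0 - I) := by
          simp only [ptC, quadPt, Prod.mk_add_mk]
          push_cast
          linear_combination I_mul_I
        rw [if_neg, if_pos rfl, e', ptC_quad, mul_div_mul_left _ _ one_add_I_ne_zero, quadPt_sub_I,
          e, walkGen_quarterTurn, walkGen_quarterTurn, walkGen_quarterTurn, quadGen, ← mul_assoc,
          ← mul_assoc, quarterPhase, ← Complex.exp_add, ← Complex.exp_add]
        · push_cast
          ring_nf
        · rw [e, quarterTurn_eq_zero, quarterTurn_eq_zero, quarterTurn_eq_zero]
          simp only [Prod.mk_eq_zero]; omega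
      · have e : ((i : ℤ) + 1 - ((j + 1 : ℕ) : ℤ), (i : ℤ) + 1 + ((j + 1 : ℕ) : ℤ)) + (1, -1) =
            ((i : ℤ) + 1 - j, (i : ℤ) + 1 + j) := by
          simp only [Prod.mk_add_mk, Prod.mk.injEq]; push_cast; omega
        rw [if_neg (Nat.succ_ne_zero j), e, move]
        simp
    have h3 : (if ((i : ℤ) + 1 - j, (i : ℤ) + 1 + j) + (-1, -1) = 0 then 0 else
        cexp (I * b * (quadPt i j).arg) *
          (cexp (I * b * (ptC (((i : ℤ) + 1 - j, (i : ℤ) + 1 + j) + (-1, -1)) /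
            ptC ((i : ℤ) + 1 - j, (i : ℤ) + 1 + j)).arg) *
          walkGen t b (((i : ℤ) + 1 - j, (i : ℤ) + 1 + j) + (-1, -1)))) =
        if i = 0 then if j = 0 then 0 else (quarterPhase b)⁻¹ * quadGen t b (j - 1) 0
          else quadGen t b (i - 1) j := by
      rcases i with _ | i
      · rcases j with _ | j
        · simp
        · have e : (((0 : ℕ) : ℤ) + 1 - ((j + 1 : ℕ) : ℤ), ((0 : ℕ) : ℤ) + 1 + ((j + 1 : ℕ) : ℤ)) +
              (-1, -1) = quarterTurn ((j : ℤ) + 1 - ((0 : ℕ) : ℤ), (j : ℤ) + 1 + ((0 : ℕ) : ℤ)) :=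
                  by
            simp only [quarterTurn, Prod.mk_add_mk, Prod.mk.injEq]; push_cast; omega
          have e' : ptC ((((0 : ℕ) : ℤ) + 1 - ((j + 1 : ℕ) : ℤ),
              ((0 : ℕ) : ℤ) + 1 + ((j + 1 : ℕ) : ℤ)) + (-1, -1)) =
              (1 + I) * (quadPt 0 (j + 1) - 1) := by
            simp only [ptC, quadPt, Prod.mk_add_mk]
            push_cast
            linear_combination (-(j + 1 : ℂ)) * I_mul_I
          rw [if_neg, if_pos rfl, if_neg (Nat.succ_ne_zero j), e', ptC_quad,
            mul_div_mul_left _ _ one_add_I_ne_zero, quadPt_sub_one, e, walkGen_quarterTurn,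
            quadGen, quarterPhase_inv, ← mul_assoc, ← mul_assoc, ← Complex.exp_add,
            ← Complex.exp_add, Nat.add_sub_cancel, quadPt_arg_zero]
          · push_cast
            ring_nf
          · rw [e, quarterTurn_eq_zero]
            simp only [Prod.mk_eq_zero]; omega
      · have e : (((i + 1 : ℕ) : ℤ) + 1 - j, ((i + 1 : ℕ) : ℤ) + 1 + j) + (-1, -1) =
            ((i : ℤ) + 1 - j, (i : ℤ) + 1 + j) := by
          simp only [Prod.mk_add_mk, Prod.mk.injEq]; push_cast; omega
        rw [if_neg (Nat.succ_ne_zero i), e, move]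
        simp
    rw [h2, h3]
    ring

section

variable {C ρ : ℝ} {q : ℕ → ℂ} (h0 : 0 < ρ) (h1 : ρ < 1)

include h0 h1

theorem summable_of_norm_le_geometric {E : Type*} [NormedAddCommGroup E] [CompleteSpace E]
    {q : ℕ → E} (hq : ∀ n, ‖q n‖ ≤ C * ρ ^ n) : Summable q :=
  ((summable_geometric_of_lt_one h0.le h1).mul_left C).of_norm_bounded hq

omit h0 h1 in
theorem norm_mul_pow_le (hq : ∀ n, ‖q n‖ ≤ C * ρ ^ n) {x : ℂ} (hx : ‖x‖ ≤ 1) (n : ℕ) :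
    ‖q n * x ^ n‖ ≤ C * ρ ^ n := by
  rw [norm_mul, norm_pow]
  exact (mul_le_of_le_one_right (norm_nonneg _) (pow_le_one₀ (norm_nonneg _) hx)).trans (hq n)

theorem diskAlg_tsum (hq : ∀ n, ‖q n‖ ≤ C * ρ ^ n) : DiskAlg fun x => ∑' n, q n * x ^ n := by
  have hs : Summable fun n => C * ρ ^ n := (summable_geometric_of_lt_one h0.le h1).mul_left C
  refine ⟨?_, ?_⟩
  · refine differentiableOn_tsum_of_summable_norm hs (fun n => by fun_prop) Metric.isOpen_ball ?_
    intro n x hx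
    exact norm_mul_pow_le hq (mem_ball_zero_iff.1 hx).le n
  · rw [closure_ball _ one_ne_zero]
    refine continuousOn_tsum (fun n => by fun_prop) hs ?_
    intro n x hx
    exact norm_mul_pow_le hq (mem_closedBall_zero_iff.1 hx) n

theorem tsum_mul_pow_eq (hq : ∀ n, ‖q n‖ ≤ C * ρ ^ n) {x : ℂ} (hx : ‖x‖ ≤ 1) :
    ∑' n, q n * x ^ n = q 0 + x * ∑' n, q (n + 1) * x ^ n := by
  rw [(summable_of_norm_le_geometric h0 h1 (norm_mul_pow_le hq hx)).tsum_eq_zero_add,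
    ← tsum_mul_left]
  congr 1
  · simp
  · exact tsum_congr fun n => by ring

theorem norm_succ_le (hC : 0 ≤ C) (hq : ∀ n, ‖q n‖ ≤ C * ρ ^ n) (n : ℕ) :
    ‖q (n + 1)‖ ≤ C * ρ ^ n :=
  (hq (n + 1)).trans (mul_le_mul_of_nonneg_left (pow_le_pow_of_le_one h0.le h1.le n.le_succ) hC)

theorem summable_prod_of_norm_le_geometric {f : ℕ × ℕ → ℂ}
    (hf : ∀ i j, ‖f (i, j)‖ ≤ C * ρ ^ (i + j)) : Summable f := by
  have hg := summable_geometric_of_lt_one h0.le h1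
  refine ((hg.mul_of_nonneg hg (fun _ => pow_nonneg h0.le _) fun _ => pow_nonneg h0.le _).mul_left
    C).of_norm_bounded fun p => ?_
  rw [← pow_add]
  exact hf p.1 p.2

end

theorem tsum_prod_split_fst {f : ℕ × ℕ → ℂ} (hf : Summable f) :
    ∑' p, f p = ∑' j, f (0, j) + ∑' p : ℕ × ℕ, f (p.1 + 1, p.2) := by
  have hinj : Function.Injective fun p : ℕ × ℕ => (p.1 + 1, p.2) := by
    rintro ⟨a, b⟩ ⟨c, d⟩ h
    simpa using h
  have hg : Summable fun p : ℕ × ℕ => f (p.1 + 1, p.2) := hf.comp_injective hinj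
  rw [hf.tsum_prod, hf.prod.tsum_eq_zero_add, hg.tsum_prod]

theorem tsum_prod_split_snd {f : ℕ × ℕ → ℂ} (hf : Summable f) :
    ∑' p, f p = ∑' i, f (i, 0) + ∑' p : ℕ × ℕ, f (p.1, p.2 + 1) := by
  have hg : Summable fun p => f (Equiv.prodComm ℕ ℕ p) := (Equiv.prodComm ℕ ℕ).summable_iff.2 hf
  rw [← (Equiv.prodComm ℕ ℕ).tsum_eq f, tsum_prod_split_fst hg,
    ← (Equiv.prodComm ℕ ℕ).tsum_eq fun p : ℕ × ℕ => f (p.1, p.2 + 1)]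
  rfl

/-- An exponentially decaying array satisfying the recursion of quarter plane walks with a twisted
gluing of the two boundaries. -/
structure TwistedRec (t : ℝ) (s : ℂ) (Q : ℕ → ℕ → ℂ) : Prop where
  bound : ∃ C ρ : ℝ, 0 ≤ C ∧ 0 < ρ ∧ ρ < 1 ∧ ∀ i j, ‖Q i j‖ ≤ C * ρ ^ (i + j)
  eq : ∀ i j, Q i j = (if i = 0 ∧ j = 0 then 1 else 0) + t * (Q (i + 1) j +
    (if i = 0 then if j = 0 then 0 else s⁻¹ * Q (j - 1) 0 else Q (i - 1) j) + Q i (j + 1) +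
      if j = 0 then s * Q 0 (i + 1) else Q i (j - 1))

theorem TwistedRec.kernel_eq {t : ℝ} {s : ℂ} {Q : ℕ → ℕ → ℂ} (h : TwistedRec t s Q)
    (hs : ‖s‖ = 1) {x y : ℂ} (hx0 : x ≠ 0) (hy0 : y ≠ 0) (hx : ‖x‖ ≤ 1) (hy : ‖y‖ ≤ 1) :
    ∃ G : ℂ, G = 1 + t * ((x + x⁻¹ + y + y⁻¹) * G - x⁻¹ * ∑' j, Q 0 j * y ^ j
      - y⁻¹ * ∑' i, Q i 0 * x ^ i + s⁻¹ * y * ∑' i, Q i 0 * y ^ i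
      + s * ∑' j, Q 0 (j + 1) * x ^ j) := by
  obtain ⟨C, ρ, hC, h0, h1, hQ⟩ := h.bound
  have bd : ∀ {c : ℂ} {D : ℝ} {i j : ℕ}, ‖c‖ ≤ D → ‖c * x ^ i * y ^ j‖ ≤ D := by
    intro c D i j hc
    rw [norm_mul, norm_mul, norm_pow, norm_pow]
    refine (mul_le_of_le_one_right (by positivity) (pow_le_one₀ (norm_nonneg _) hy)).trans ?_
    exact (mul_le_of_le_one_right (by positivity) (pow_le_one₀ (norm_nonneg _) hx)).trans hc
  have pl : ∀ {m n : ℕ}, n ≤ m → C * ρ ^ m ≤ C / ρ * ρ ^ (n + 1) := by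
    intro m n hmn
    rw [pow_succ, div_mul_eq_mul_div, mul_div_assoc, mul_div_cancel_right₀ _ h0.ne']
    exact mul_le_mul_of_nonneg_left (pow_le_pow_of_le_one h0.le h1.le hmn) hC
  have pl' : ∀ {m n : ℕ}, n ≤ m + 1 → C * ρ ^ m ≤ C / ρ * ρ ^ n := by
    intro m n hmn
    rcases n with _ | n
    · rw [pow_zero, mul_one]
      refine (mul_le_of_le_one_right hC (pow_le_one₀ h0.le h1.le)).trans ?_
      rw [le_div_iff₀ h0]
      exact mul_le_of_le_one_right hC h1.le
    · exact pl (by omega)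
  set f : ℕ × ℕ → ℂ := fun p => Q p.1 p.2 * x ^ p.1 * y ^ p.2 with hf
  set f1 : ℕ × ℕ → ℂ := fun p => Q (p.1 + 1) p.2 * x ^ p.1 * y ^ p.2 with hf1
  set f2 : ℕ × ℕ → ℂ := fun p => (if p.1 = 0 then if p.2 = 0 then 0 else s⁻¹ * Q (p.2 - 1) 0
    else Q (p.1 - 1) p.2) * x ^ p.1 * y ^ p.2 with hf2
  set f3 : ℕ × ℕ → ℂ := fun p => Q p.1 (p.2 + 1) * x ^ p.1 * y ^ p.2 with hf3
  set f4 : ℕ × ℕ → ℂ := fun p => (if p.2 = 0 then s * Q 0 (p.1 + 1) else Q p.1 (p.2 - 1)) *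
    x ^ p.1 * y ^ p.2 with hf4
  have sf : Summable f := summable_prod_of_norm_le_geometric h0 h1 fun i j => bd (hQ i j)
  have sf1 : Summable f1 := summable_prod_of_norm_le_geometric h0 h1 (C := C / ρ) fun i j =>
    bd ((hQ _ _).trans (pl' (by omega)))
  have sf3 : Summable f3 := summable_prod_of_norm_le_geometric h0 h1 (C := C / ρ) fun i j =>
    bd ((hQ _ _).trans (pl' (by omega)))
  have sf2 : Summable f2 := by
    refine summable_prod_of_norm_le_geometric h0 h1 (C := C / ρ) fun i j => bd ?_
    dsimp only
    split_ifs
    · rw [norm_zero]; positivity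
    · rw [norm_mul, norm_inv, hs, inv_one, one_mul]
      exact (hQ _ _).trans (pl' (by omega))
    · exact (hQ _ _).trans (pl' (by omega))
  have sf4 : Summable f4 := by
    refine summable_prod_of_norm_le_geometric h0 h1 (C := C / ρ) fun i j => bd ?_
    dsimp only
    split_ifs
    · rw [norm_mul, hs, one_mul]
      exact (hQ _ _).trans (pl' (by omega))
    · exact (hQ _ _).trans (pl' (by omega))
  have e1 : x * ∑' p, f1 p = ∑' p, f p - ∑' j, Q 0 j * y ^ j := by
    rw [tsum_prod_split_fst sf, ← tsum_mul_left]
    simp only [hf, hf1, pow_zero, mul_one, pow_succ]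
    rw [add_sub_cancel_left]
    exact tsum_congr fun p => by ring
  have e3 : y * ∑' p, f3 p = ∑' p, f p - ∑' i, Q i 0 * x ^ i := by
    rw [tsum_prod_split_snd sf, ← tsum_mul_left]
    simp only [hf, hf3, pow_zero, mul_one, pow_succ]
    rw [add_sub_cancel_left]
    exact tsum_congr fun p => by ring
  have e2 : ∑' p, f2 p = s⁻¹ * y * ∑' i, Q i 0 * y ^ i + x * ∑' p, f p := by
    rw [tsum_prod_split_fst sf2, ← tsum_mul_left, ← tsum_mul_left]
    congr 1
    · have hsum : Summable fun j => f2 (0, j) := sf2.comp_injective (Prod.mk_right_injective 0)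
      rw [hsum.tsum_eq_zero_add]
      simp only [hf2, if_true, if_neg (Nat.succ_ne_zero _), Nat.add_sub_cancel, zero_add,
        pow_zero, mul_one, pow_succ]
      exact tsum_congr fun p => by ring
    · simp only [hf, hf2, if_neg (Nat.succ_ne_zero _), Nat.add_sub_cancel, pow_succ]
      exact tsum_congr fun p => by ring
  have e4 : ∑' p, f4 p = s * ∑' j, Q 0 (j + 1) * x ^ j + y * ∑' p, f p := by
    rw [tsum_prod_split_snd sf4, ← tsum_mul_left, ← tsum_mul_left]
    congr 1
    · simp only [hf4, if_true, pow_zero, mul_one]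
      exact tsum_congr fun p => by ring
    · simp only [hf, hf4, if_neg (Nat.succ_ne_zero _), Nat.add_sub_cancel, pow_succ]
      exact tsum_congr fun p => by ring
  have hδ : HasSum (fun p : ℕ × ℕ => if p = (0, 0) then (1 : ℂ) else 0) 1 := hasSum_ite_eq _ _
  have key := hδ.add
    ((((sf1.hasSum.add sf2.hasSum).add sf3.hasSum).add sf4.hasSum).mul_left (t : ℂ))
  have : f = fun p => (if p = (0, 0) then (1 : ℂ) else 0) + t * (f1 p + f2 p + f3 p + f4 p) := by
    funext p
    obtain ⟨i, j⟩ := p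
    simp only [hf, hf1, hf2, hf3, hf4, Prod.mk.injEq]
    conv_lhs => rw [h.eq i j]
    by_cases hij : i = 0 ∧ j = 0
    · obtain ⟨rfl, rfl⟩ := hij
      simp
    · simp only [if_neg hij]
      ring
  refine ⟨∑' p, f p, ?_⟩
  have hG : ∑' p, f p = 1 + t * (∑' p, f1 p + ∑' p, f2 p + ∑' p, f3 p + ∑' p, f4 p) := by
    conv_lhs => rw [this]
    exact key.tsum_eq
  have e1' : ∑' p, f1 p = x⁻¹ * (∑' p, f p - ∑' j, Q 0 j * y ^ j) := by
    rw [← e1, inv_mul_cancel_left₀ hx0]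
  have e3' : ∑' p, f3 p = y⁻¹ * (∑' p, f p - ∑' i, Q i 0 * x ^ i) := by
    rw [← e3, inv_mul_cancel_left₀ hy0]
  rw [e1', e2, e3', e4] at hG
  linear_combination hG

theorem TwistedRec.exists_isSimple {t : ℝ} {s : ℂ} {Q : ℕ → ℕ → ℂ} (h : TwistedRec t s Q)
    (ht : t ≠ 0) (hs : ‖s‖ = 1) (hs1 : s ≠ 1) :
    ∃ κ a b, IsSimple t s κ a b ∧
      κ * (1 - s⁻¹) + (t : ℂ)⁻¹ = (1 + s⁻¹) * (s + s⁻¹) * t * Q 0 0 := by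
  obtain ⟨C, ρ, hC, h0, h1, hQ⟩ := h.bound
  have hs0 : s ≠ 0 := norm_pos_iff.1 (by rw [hs]; exact one_pos)
  have ht0 : (t : ℂ) ≠ 0 := by exact_mod_cast ht
  have hs2 : (1 : ℂ) - s⁻¹ ≠ 0 := sub_ne_zero.2 fun e => hs1 (inv_eq_one.1 e.symm)
  have hss : s * s⁻¹ = 1 := mul_inv_cancel₀ hs0
  have htt : (t : ℂ) * (t : ℂ)⁻¹ = 1 := mul_inv_cancel₀ ht0
  have b1 : ∀ n, ‖Q 0 n‖ ≤ C * ρ ^ n := fun n => by simpa using hQ 0 n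
  have b2 : ∀ n, ‖Q n 0‖ ≤ C * ρ ^ n := fun n => by simpa using hQ n 0
  set ν := (1 + s⁻¹) * (s + s⁻¹) with hν
  have hsν : s * ν = s ^ 2 + 1 + s + s⁻¹ := by
    rw [hν]
    linear_combination (1 + s + s⁻¹) * hss
  clear_value ν
  set G₁ : ℂ → ℂ := fun x => ∑' n, Q 0 (n + 1) * x ^ n with hG₁
  set H₀ : ℂ → ℂ := fun x => ∑' n, Q n 0 * x ^ n with hH₀
  set H₁ : ℂ → ℂ := fun x => ∑' n, Q (n + 1) 0 * x ^ n with hH₁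
  have dG₁ : DiskAlg G₁ := diskAlg_tsum h0 h1 (norm_succ_le h0 h1 hC b1)
  have dH₁ : DiskAlg H₁ := diskAlg_tsum h0 h1 (norm_succ_le h0 h1 hC b2)
  have hG₀ : ∀ x : ℂ, ‖x‖ ≤ 1 → ∑' n, Q 0 n * x ^ n = Q 0 0 + x * G₁ x := fun x hx =>
    tsum_mul_pow_eq h0 h1 b1 hx
  have hH : ∀ x : ℂ, ‖x‖ ≤ 1 → H₀ x = Q 0 0 + x * H₁ x := fun x hx =>
    tsum_mul_pow_eq h0 h1 b2 hx
  obtain ⟨κ, hκ⟩ : ∃ κ : ℂ, κ * (1 - s⁻¹) + (t : ℂ)⁻¹ = ν * t * Q 0 0 :=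
    ⟨(ν * t * Q 0 0 - (t : ℂ)⁻¹) / (1 - s⁻¹), by rw [div_mul_cancel₀ _ hs2]; ring⟩
  refine ⟨κ, fun x => x⁻¹ + κ + x * (-s - ν * (s * t) * G₁ x),
    fun x => 1 + s⁻¹ + ν * t * (x * H₀ x), ⟨?_, ?_⟩, hκ⟩
  · intro x y hx0 hy0 hx hy hxy
    obtain ⟨G, hG⟩ := h.kernel_eq hs hx0 hy0 hx hy
    rw [hxy, hG₀ y hy] at hG
    change G = 1 + t * ((t : ℂ)⁻¹ * G - x⁻¹ * (Q 0 0 + y * G₁ y) - y⁻¹ * H₀ x + s⁻¹ * y * H₀ y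
      + s * G₁ x) at hG
    have hxx : x * x⁻¹ = 1 := mul_inv_cancel₀ hx0
    have hfe : x + t * (-(Q 0 0 + y * G₁ y) - x * y⁻¹ * H₀ x + s⁻¹ * x * y * H₀ y + s * x * G₁ x)
        = 0 := by
      linear_combination (-x) * hG - x * G * htt + t * (Q 0 0 + y * G₁ y) * hxx
    dsimp only
    linear_combination (-(s * ν)) * hfe + s * hxy + s * hκ + x * hsν +
      (ν * t * x * y * H₀ y + κ + y⁻¹) * hss
  · refine ⟨fun x => -s - ν * (s * t) * G₁ x, fun x => ν * t * H₁ x, ?_, ?_, ?_⟩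
    · repeat' first | assumption | exact DiskAlg.const _ | exact DiskAlg.id | apply DiskAlg.mul |
        apply DiskAlg.add | apply DiskAlg.sub
    · repeat' first | assumption | exact DiskAlg.const _ | exact DiskAlg.id | apply DiskAlg.mul
    · intro x _ hx
      refine ⟨rfl, ?_⟩
      dsimp only
      rw [hH x hx]
      linear_combination (-x) * hκ

theorem norm_quarterPhase (b : ℝ) : ‖quarterPhase b‖ = 1 := norm_exp_I_mul _ _

theorem exists_quarterPhase_eq {s : ℂ} (hs : ‖s‖ = 1) : ∃ b, quarterPhase b = s := by
  refine ⟨-(2 * s.arg / π), ?_⟩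
  have h := norm_mul_exp_arg_mul_I s
  rw [hs, ofReal_one, one_mul] at h
  rw [quarterPhase]
  refine Eq.trans ?_ h
  congr 1
  have : (π : ℂ) ≠ 0 := by exact_mod_cast Real.pi_ne_zero
  push_cast
  field_simp

theorem twistedRec_quadGen {t : ℝ} (ht : t ∈ Ioo (0 : ℝ) (1 / 4)) (b : ℝ) :
    TwistedRec t (quarterPhase b) (quadGen t b) where
  bound := ⟨(1 - 4 * t)⁻¹, 4 * t, inv_nonneg.2 (by linarith [ht.2]), by linarith [ht.1],
    by linarith [ht.2], norm_quadGen_le ht b⟩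
  eq := quadGen_eq ht b

theorem exists_isSimple_quarterPhase {t : ℝ} (ht : t ∈ Ioo (0 : ℝ) (1 / 4)) {b : ℝ} {s : ℂ}
    (hb : quarterPhase b = s) (hs1 : s ≠ 1) :
    ∃ κ a b', IsSimple t s κ a b' ∧
      (1 + s⁻¹) * (s + s⁻¹) * Fchar t b = 4 * t * (κ * (1 - s⁻¹) + (t : ℂ)⁻¹) := by
  subst hb
  obtain ⟨κ, a, b', h, hκ⟩ :=
    (twistedRec_quadGen ht b).exists_isSimple ht.1.ne' (norm_quarterPhase b) hs1
  refine ⟨κ, a, b', h, ?_⟩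
  have h00 : quadGen t b 0 0 = walkGen t b (1, 1) := by
    rw [quadGen, quadPt_arg_zero]
    simp
  rw [hκ, Fchar_eq_walkGen ht, h00]
  ring

theorem exists_sectionRelations_Fchar {t : ℝ} (ht : t ∈ Ioo (0 : ℝ) (1 / 4)) :
    ∃ k g, SectionRelations t k g ∧ ∀ b s, quarterPhase b = s → s ≠ 1 →
      (1 + s⁻¹) * (s + s⁻¹) * Fchar t b =
        4 * t * ((k s - (2 * t : ℂ)⁻¹) * (1 - s⁻¹) + (t : ℂ)⁻¹) := by
  have H : ∀ s : ℂ, ‖s‖ = 1 → s ≠ 1 → ∃ κ a b, IsSimple t s κ a b := by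
    intro s hs hs1
    obtain ⟨b, hb⟩ := exists_quarterPhase_eq hs
    obtain ⟨κ, a, b', h, -⟩ := exists_isSimple_quarterPhase ht hb hs1
    exact ⟨κ, a, b', h⟩
  obtain ⟨k, g, hkg, hk⟩ := exists_sectionRelations ht H
  refine ⟨k, g, hkg, fun b s hb hs1 => ?_⟩
  obtain ⟨κ, a, b', h, hF⟩ := exists_isSimple_quarterPhase ht hb hs1
  rw [hF, hk s κ a b' (hb ▸ norm_quarterPhase b) hs1 h]
  ring

/-- Points of the unit circle other than `1` and `-1`. -/
structure IsGenericUnit (u : ℂ) : Prop where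
  norm_eq : ‖u‖ = 1
  ne_one : u ≠ 1
  neg_ne_one : -u ≠ 1

namespace IsGenericUnit

variable {u : ℂ}

theorem ne_zero (hu : IsGenericUnit u) : u ≠ 0 := norm_pos_iff.1 (by rw [hu.norm_eq]; exact one_pos)

theorem neg (hu : IsGenericUnit u) : IsGenericUnit (-u) :=
  ⟨by rw [norm_neg, hu.norm_eq], hu.neg_ne_one, by rw [neg_neg]; exact hu.ne_one⟩

theorem inv (hu : IsGenericUnit u) : IsGenericUnit u⁻¹ :=
  ⟨by rw [norm_inv, hu.norm_eq, inv_one], fun h => hu.ne_one (inv_eq_one.1 h),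
    fun h => hu.neg_ne_one (inv_eq_one.1 (by rw [inv_neg, h]))⟩

theorem of_sq_ne_one (h1 : ‖u‖ = 1) (h2 : u ^ 2 ≠ 1) : IsGenericUnit u :=
  ⟨h1, fun h => h2 (by rw [h, one_pow]), fun h => h2 (by rw [← neg_sq, h, one_pow])⟩

end IsGenericUnit

/-- The square of the modulus appearing in the multiplication relations. -/
def sectionModulus (t : ℝ) : ℂ := (2 * t : ℂ)⁻¹ ^ 2 - 4

theorem sectionModulus_ne_zero {t : ℝ} (ht : t ∈ Ioo (0 : ℝ) (1 / 4)) : sectionModulus t ≠ 0 := by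
  have h := four_lt_inv ht
  have e : sectionModulus t = (((2 * t)⁻¹ ^ 2 - 4 : ℝ) : ℂ) := by
    rw [sectionModulus]
    push_cast
    rfl
  rw [e]
  have : 2 < (2 * t)⁻¹ := by
    rw [mul_inv]
    linarith
  have : (2 * t)⁻¹ ^ 2 - 4 ≠ 0 := by nlinarith
  exact_mod_cast this

/-- The odd part of a function on the circle. -/
def oddDiff (k : ℂ → ℂ) (u : ℂ) : ℂ := k u - k (-u)

/-- The ratio of the values of a function at opposite points. -/
def oppRatio (g : ℂ → ℂ) (u : ℂ) : ℂ := g u / g (-u)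

namespace SectionRelations

variable {t : ℝ} {k g : ℂ → ℂ} (h : SectionRelations t k g) (ht : t ∈ Ioo (0 : ℝ) (1 / 4)) {u v : ℂ}

include h

theorem oddDiff_inv (hu : IsGenericUnit u) : oddDiff k u⁻¹ = -oddDiff k u := by
  have e : -u⁻¹ = (-u)⁻¹ := by rw [inv_neg]
  rw [oddDiff, oddDiff, e, h.inv u hu.norm_eq hu.ne_one, h.inv (-u) hu.neg.norm_eq hu.neg.ne_one]
  ring

theorem apply_mul_apply_neg_inv (hu : IsGenericUnit u) : g u * g (-u⁻¹) = sectionModulus t :=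
  h.mul_neg_inv u hu.norm_eq hu.ne_one hu.neg_ne_one

theorem apply_neg_mul_apply_inv (hu : IsGenericUnit u) : g (-u) * g u⁻¹ = sectionModulus t := by
  have := h.apply_mul_apply_neg_inv hu.neg
  rwa [inv_neg, neg_neg] at this

theorem cross_add (hu : IsGenericUnit u) (hv : IsGenericUnit v) (huv : IsGenericUnit (u * v)) :
    g u * g v - g (-u) * g (-v) = (oddDiff k u + oddDiff k v) * g (u * v) := by
  have h1 := h.mul u v hu.norm_eq hv.norm_eq hu.ne_one hv.ne_one huv.ne_one huv.neg_ne_one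
  have h2 := h.mul (-u) (-v) hu.neg.norm_eq hv.neg.norm_eq hu.neg.ne_one hv.neg.ne_one
    (by rw [neg_mul_neg]; exact huv.ne_one) (by rw [neg_mul_neg]; exact huv.neg_ne_one)
  rw [neg_mul_neg] at h2
  rw [oddDiff, oddDiff]
  linear_combination h1 - h2

theorem cross_sub (hu : IsGenericUnit u) (hv : IsGenericUnit v) (huv : IsGenericUnit (u * v)) :
    g u * g (-v) - g (-u) * g v = (oddDiff k u - oddDiff k v) * g (-(u * v)) := by
  have h1 := h.cross_add hu hv.neg (by rw [mul_neg]; exact huv.neg)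
  rw [neg_neg, mul_neg] at h1
  rw [h1, oddDiff, oddDiff, oddDiff, neg_neg]
  ring

include ht

theorem apply_ne_zero (hu : IsGenericUnit u) : g u ≠ 0 := fun h0 =>
  sectionModulus_ne_zero ht (by rw [← h.apply_mul_apply_neg_inv hu, h0, zero_mul])

theorem oppRatio_ne_zero (hu : IsGenericUnit u) : oppRatio g u ≠ 0 :=
  div_ne_zero (h.apply_ne_zero ht hu) (h.apply_ne_zero ht hu.neg)

theorem apply_eq (hu : IsGenericUnit u) : g u = oppRatio g u * g (-u) :=
  (div_mul_cancel₀ _ (h.apply_ne_zero ht hu.neg)).symm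

theorem oppRatio_inv (hu : IsGenericUnit u) : oppRatio g u⁻¹ = oppRatio g u := by
  rw [oppRatio, oppRatio, div_eq_div_iff (h.apply_ne_zero ht hu.inv.neg)
    (h.apply_ne_zero ht hu.neg), mul_comm, h.apply_neg_mul_apply_inv hu,
    h.apply_mul_apply_neg_inv hu]

omit h ht in
theorem oppRatio_neg (g : ℂ → ℂ) (u : ℂ) : oppRatio g (-u) = (oppRatio g u)⁻¹ := by
  rw [oppRatio, oppRatio, neg_neg, inv_div]

theorem oddDiff_sq (hu : IsGenericUnit u) : oppRatio g u * oddDiff k u ^ 2 =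
    -(sectionModulus t * (oppRatio g u ^ 2 + 1)) - 2 * (sectionModulus t + 8) * oppRatio g u := by
  have h1 := h.add u hu.norm_eq hu.ne_one hu.neg_ne_one
  have h2 := h.apply_mul_apply_neg_inv hu
  have h3 := h.apply_neg_mul_apply_inv hu
  have h4 := h.apply_eq ht hu
  have h5 := h.apply_eq ht hu.inv
  rw [h.oppRatio_inv ht hu] at h5
  set r := oppRatio g u
  have hd : oddDiff k u ^ 2 = -(g u * g u⁻¹) - g (-u) * g (-u⁻¹) - 2 * (2 * t : ℂ)⁻¹ ^ 2 - 8 := by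
    rw [oddDiff]
    linear_combination -h1
  rw [hd]
  have h6 : (2 * t : ℂ)⁻¹ ^ 2 = sectionModulus t + 4 := by rw [sectionModulus]; ring
  rw [h6]
  rw [h4] at h2 ⊢
  rw [h5] at h3 ⊢
  linear_combination (-r ^ 2 - 1) * h3

theorem doubling (hu : IsGenericUnit u) (hu2 : IsGenericUnit (u * u)) :
    -4 * oddDiff k u ^ 2 * oppRatio g u ^ 2 * oppRatio g (u * u) =
      sectionModulus t * (oppRatio g u ^ 2 - 1) ^ 2 := by
  have h1 := h.cross_add hu hu hu2
  have h2 := h.cross_add hu.inv hu.inv (by rw [← mul_inv]; exact hu2.inv)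
  rw [← mul_inv, h.oddDiff_inv hu] at h2
  have h3 := h.apply_neg_mul_apply_inv hu2
  have h4 := h.apply_mul_apply_neg_inv hu
  have h5 := h.apply_neg_mul_apply_inv hu
  have n1 := h.apply_ne_zero ht hu
  have n2 := h.apply_ne_zero ht hu.neg
  have n4 := h.apply_ne_zero ht hu2.neg
  have n5 := sectionModulus_ne_zero ht
  have e4 : g (-u⁻¹) = sectionModulus t / g u := by rw [← h4, mul_div_cancel_left₀ _ n1]
  have e5 : g u⁻¹ = sectionModulus t / g (-u) := by rw [← h5, mul_div_cancel_left₀ _ n2]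
  have e3 : g (u * u)⁻¹ = sectionModulus t / g (-(u * u)) := by
    rw [← h3, mul_div_cancel_left₀ _ n4]
  rw [e3, e4, e5] at h2
  rw [oppRatio, oppRatio]
  clear e3 e4 e5 h3 h4 h5
  generalize sectionModulus t = γ at *
  generalize g (-(u * u)) = x at *
  generalize g (u * u) = y at *
  generalize g u = a at *
  generalize g (-u) = c at *
  generalize oddDiff k u = d at *
  have h6 : γ * (a ^ 2 - c ^ 2) * x = -2 * d * (a ^ 2 * c ^ 2) := by
    field_simp at h2
    linear_combination h2
  field_simp
  linear_combination -(a ^ 2 - c ^ 2) * h6 + 2 * d * (a ^ 2 * c ^ 2) * h1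

theorem oddDiff_ne_zero (hu : IsGenericUnit u) (hu2 : IsGenericUnit (u * u)) :
    oddDiff k u ≠ 0 := by
  intro h0
  have h1 := h.doubling ht hu hu2
  have h2 := h.oddDiff_sq ht hu
  rw [h0] at h1 h2
  have h3 : (oppRatio g u ^ 2 - 1) ^ 2 = 0 := by
    refine (mul_eq_zero.1 ?_).resolve_left (sectionModulus_ne_zero ht)
    rw [← h1]
    ring
  have h4 : (oppRatio g u - 1) * (oppRatio g u + 1) = 0 := by
    linear_combination pow_eq_zero_iff two_ne_zero |>.1 h3
  rcases mul_eq_zero.1 h4 with h5 | h5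
  · rw [sub_eq_zero.1 h5, sectionModulus] at h2
    have h6 : (2 * t : ℂ)⁻¹ ^ 2 = 0 := by linear_combination (1 / 4 : ℂ) * h2
    have ht0 : (t : ℂ) ≠ 0 := by exact_mod_cast ht.1.ne'
    exact pow_ne_zero 2 (inv_ne_zero (mul_ne_zero two_ne_zero ht0)) h6
  · rw [eq_neg_of_add_eq_zero_left h5] at h2
    have : (16 : ℂ) = 0 := by linear_combination -h2
    norm_num at this

theorem oppRatio_sq_ne_one (hu : IsGenericUnit u) (hu2 : IsGenericUnit (u * u)) :
    oppRatio g u ^ 2 ≠ 1 := by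
  intro h0
  have h1 := h.doubling ht hu hu2
  rw [h0] at h1
  have h2 := h.oddDiff_ne_zero ht hu hu2
  have h3 := h.oppRatio_ne_zero ht hu2
  refine mul_ne_zero (pow_ne_zero 2 h2) h3 ?_
  linear_combination (-1 / 4 : ℂ) * h1

section

variable (hu : IsGenericUnit u) (hv : IsGenericUnit v) (huv : IsGenericUnit (u * v))

include hu hv huv

theorem mul_sub_one_eq :
    (oppRatio g u * oppRatio g v - 1) * (g (-u) * g (-v)) =
      (oddDiff k u + oddDiff k v) * g (u * v) := by
  rw [← h.cross_add hu hv huv]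
  linear_combination (-g v) * h.apply_eq ht hu - oppRatio g u * g (-u) * h.apply_eq ht hv

theorem sub_eq :
    (oppRatio g u - oppRatio g v) * (g (-u) * g (-v)) =
      (oddDiff k u - oddDiff k v) * g (-(u * v)) := by
  rw [← h.cross_sub hu hv huv]
  linear_combination g (-u) * h.apply_eq ht hv - g (-v) * h.apply_eq ht hu

theorem oppRatio_mul : (oppRatio g u * oppRatio g v - 1) * (oddDiff k u - oddDiff k v) =
    (oppRatio g u - oppRatio g v) * (oddDiff k u + oddDiff k v) * oppRatio g (u * v) := by
  have h1 := h.mul_sub_one_eq ht hu hv huv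
  have h2 := h.sub_eq ht hu hv huv
  rw [h.apply_eq ht huv] at h1
  have n1 := h.apply_ne_zero ht hu.neg
  have n2 := h.apply_ne_zero ht hv.neg
  have n3 := h.apply_ne_zero ht huv.neg
  refine mul_right_cancel₀ (mul_ne_zero (mul_ne_zero n1 n2) n3) ?_
  linear_combination (oddDiff k u - oddDiff k v) * g (-(u * v)) * h1 -
    (oddDiff k u + oddDiff k v) * oppRatio g (u * v) * g (-(u * v)) * h2

theorem apply_eq_sub : (k u + k v - k (-(u * v))) * (oppRatio g u * oppRatio g v - 1) =
    (oddDiff k u + oddDiff k v) * (oppRatio g u * oppRatio g v) := by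
  have h1 := h.mul u v hu.norm_eq hv.norm_eq hu.ne_one hv.ne_one huv.ne_one huv.neg_ne_one
  have h2 := h.mul_sub_one_eq ht hu hv huv
  have n1 := h.apply_ne_zero ht hu.neg
  have n2 := h.apply_ne_zero ht hv.neg
  have n3 := h.apply_ne_zero ht huv
  rw [h.apply_eq ht hu, h.apply_eq ht hv] at h1
  refine mul_right_cancel₀ (mul_ne_zero (mul_ne_zero n1 n2) n3) ?_
  linear_combination (k u + k v - k (-(u * v))) * g (u * v) * h2 -
    (oddDiff k u + oddDiff k v) * g (u * v) * h1

variable (huv2 : IsGenericUnit (u * v⁻¹)) (hv2 : IsGenericUnit (v * v))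

include huv2 hv2

theorem oppRatio_ne : oppRatio g u ≠ oppRatio g v := by
  intro h0
  have h1 := h.sub_eq ht hu hv huv
  have h2 := h.sub_eq ht hu hv.inv huv2
  rw [h.oppRatio_inv ht hv, h.oddDiff_inv hv, h0, sub_self, zero_mul, eq_comm, mul_eq_zero,
    or_iff_left (h.apply_ne_zero ht huv2.neg)] at h2
  rw [h0, sub_self, zero_mul, eq_comm, mul_eq_zero,
    or_iff_left (h.apply_ne_zero ht huv.neg)] at h1
  refine h.oddDiff_ne_zero ht hv hv2 ?_
  linear_combination (1 / 2 : ℂ) * h2 - (1 / 2 : ℂ) * h1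

theorem oppRatio_mul_ne_one : oppRatio g u * oppRatio g v ≠ 1 := by
  intro h0
  have h1 := h.mul_sub_one_eq ht hu hv huv
  have h2 := h.mul_sub_one_eq ht hu hv.inv huv2
  rw [h.oppRatio_inv ht hv, h.oddDiff_inv hv, h0, sub_self, zero_mul, eq_comm, mul_eq_zero,
    or_iff_left (h.apply_ne_zero ht huv2)] at h2
  rw [h0, sub_self, zero_mul, eq_comm, mul_eq_zero,
    or_iff_left (h.apply_ne_zero ht huv)] at h1
  refine h.oddDiff_ne_zero ht hv hv2 ?_
  linear_combination (1 / 2 : ℂ) * h1 - (1 / 2 : ℂ) * h2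

theorem oppRatio_mul_mul_div :
    oppRatio g (u * v) * oppRatio g (u * v⁻¹) * (oppRatio g u - oppRatio g v) ^ 2 =
      (oppRatio g u * oppRatio g v - 1) ^ 2 := by
  have h1 := h.oppRatio_mul ht hu hv huv
  have h2 := h.oppRatio_mul ht hu hv.inv huv2
  rw [h.oppRatio_inv ht hv, h.oddDiff_inv hv] at h2
  have h3 := h.oddDiff_sq ht hu
  have h4 := h.oddDiff_sq ht hv
  have n1 := sub_ne_zero.2 (h.oppRatio_ne ht hu hv huv huv2 hv2)
  have n2 := sub_ne_zero.2 (h.oppRatio_mul_ne_one ht hu hv huv huv2 hv2)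
  have h5 : oppRatio g u * oppRatio g v * (oddDiff k u ^ 2 - oddDiff k v ^ 2) =
      -sectionModulus t * (oppRatio g u - oppRatio g v) * (oppRatio g u * oppRatio g v - 1) := by
    linear_combination oppRatio g v * h3 - oppRatio g u * h4
  have h6 : oddDiff k u ^ 2 - oddDiff k v ^ 2 ≠ 0 := by
    intro h0
    rw [h0, mul_zero] at h5
    exact mul_ne_zero (mul_ne_zero (neg_ne_zero.2 (sectionModulus_ne_zero ht)) n1) n2 h5.symm
  refine mul_right_cancel₀ h6 ?_
  linear_combination (-(oppRatio g u - oppRatio g v) * (oddDiff k u - oddDiff k v) *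
    oppRatio g (u * v⁻¹)) * h1 - (oppRatio g u * oppRatio g v - 1) *
        (oddDiff k u - oddDiff k v) * h2

end

end SectionRelations

section

open Polynomial

variable {R S : Type*} [CommRing R] [CommRing S] [Algebra R S]

/-- `y` is the value at `x` of a rational function behaving like `X / c` at infinity. -/
def HasLinearGrowth (x y : S) (c : R) : Prop :=
  ∃ N M : R[X], ∃ d : ℕ, N.natDegree ≤ d + 1 ∧ M.natDegree ≤ d ∧ N.coeff (d + 1) ≠ 0 ∧
    M.coeff d = c * N.coeff (d + 1) ∧ aeval x M * y = aeval x N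

theorem hasLinearGrowth_self [Nontrivial R] (x : S) : HasLinearGrowth x x (1 : R) :=
  ⟨X, 1, 0, natDegree_X_le, natDegree_one.le, by simp, by simp, by simp⟩

theorem HasLinearGrowth.of_doubling [IsDomain R] {x y : S} {p q : R} (hp : p ≠ 0)
    (hxy : 4 * x * (algebraMap R S p * (x ^ 2 + 1) + 2 * algebraMap R S q * x) * y =
      algebraMap R S p * (x ^ 2 - 1) ^ 2) : HasLinearGrowth x y (4 : R) := by
  refine ⟨C p * (X ^ 2 - 1) ^ 2, C 4 * X * (C p * (X ^ 2 + 1) + C (2 * q) * X), 3, ?_, ?_, ?_,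
    ?_, ?_⟩
  · compute_degree
  · compute_degree
  · have : (C p * (X ^ 2 - 1) ^ 2 : R[X]).coeff (3 + 1) = p := by
      compute_degree!
    rwa [this]
  · have : (C p * (X ^ 2 - 1) ^ 2 : R[X]).coeff (3 + 1) = p := by
      compute_degree!
    rw [this]
    compute_degree!
  · simp only [map_mul, map_add, map_sub, map_pow, map_one, aeval_X, aeval_C, map_ofNat]
    rw [← hxy]

theorem HasLinearGrowth.step [IsDomain R] {x y z w : S} {c e f : R} (hy : HasLinearGrowth x y c)
    (hz : HasLinearGrowth x z e) (he : e ≠ 0) (hf : f * e = (c - 1) ^ 2)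
    (hw : w * z * (y - x) ^ 2 = (y * x - 1) ^ 2) : HasLinearGrowth x w f := by
  obtain ⟨N, M, d, hN, hM, ha, hc, hMN⟩ := hy
  obtain ⟨N', M', d', hN', hM', ha', hc', hMN'⟩ := hz
  have b1 : (N * X - M).natDegree ≤ d + 2 :=
    (natDegree_sub_le_of_le (natDegree_mul_le_of_le hN natDegree_X_le)
      (hM.trans (by omega : d ≤ d + 1 + 1))).trans (by omega)
  have b2 : (N - M * X).natDegree ≤ d + 1 :=
    (natDegree_sub_le_of_le hN (natDegree_mul_le_of_le hM natDegree_X_le)).trans (by omega)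
  have b3 := natDegree_pow_le_of_le 2 b1
  have b4 := natDegree_pow_le_of_le 2 b2
  have l1 : (N * X - M).coeff (d + 2) = N.coeff (d + 1) := by
    rw [coeff_sub, coeff_mul_X, coeff_eq_zero_of_natDegree_lt (p := M) (by omega), sub_zero]
  have l2 : (N - M * X).coeff (d + 1) = (1 - c) * N.coeff (d + 1) := by
    rw [coeff_sub, coeff_mul_X, hc]
    ring
  have l3 := coeff_pow_of_natDegree_le (m := 2) b1
  have l4 := coeff_pow_of_natDegree_le (m := 2) b2
  have l5 : ((N * X - M) ^ 2 * M').coeff (2 * d + d' + 3 + 1) =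
      N.coeff (d + 1) ^ 2 * (e * N'.coeff (d' + 1)) := by
    have := coeff_mul_add_eq_of_natDegree_le b3 hM'
    rw [← hc', ← l1, ← l3, ← this]
    congr 1
    ring
  have l6 : (N' * (N - M * X) ^ 2).coeff (2 * d + d' + 3) =
      N'.coeff (d' + 1) * ((1 - c) * N.coeff (d + 1)) ^ 2 := by
    have := coeff_mul_add_eq_of_natDegree_le hN' b4
    rw [← l2, ← l4, ← this]
    congr 1
    ring
  refine ⟨(N * X - M) ^ 2 * M', N' * (N - M * X) ^ 2, 2 * d + d' + 3,
    (natDegree_mul_le_of_le b3 hM').trans (by omega),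
    (natDegree_mul_le_of_le hN' b4).trans (by omega), ?_, ?_, ?_⟩
  · rw [l5]
    exact mul_ne_zero (pow_ne_zero 2 ha) (mul_ne_zero he ha')
  · rw [l5, l6]
    linear_combination -(N.coeff (d + 1) ^ 2 * N'.coeff (d' + 1)) * hf
  · simp only [map_mul, map_sub, map_pow, aeval_X]
    rw [← hMN, ← hMN']
    linear_combination (aeval x M' * aeval x M ^ 2) * hw

theorem HasLinearGrowth.isAlgebraic_of_self [IsDomain R] {x : S} {c : R}
    (h : HasLinearGrowth x x c) (hc : c ≠ 1) : IsAlgebraic R x := by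
  obtain ⟨N, M, d, -, -, ha, hM, e⟩ := h
  refine ⟨N - M * X, fun h0 => ?_, ?_⟩
  · have := congrArg (fun p => p.coeff (d + 1)) h0
    simp only [coeff_sub, coeff_mul_X, coeff_zero, hM] at this
    refine mul_ne_zero (sub_ne_zero.2 hc.symm) ha ?_
    linear_combination this
  · rw [map_sub, map_mul, aeval_X, e, sub_self]

theorem HasLinearGrowth.isAlgebraic_of_mul_eq_one {x y : S} {c : R}
    (h : HasLinearGrowth x y c) (hxy : y * x = 1) : IsAlgebraic R x := by
  obtain ⟨N, M, d, hN, hM, ha, -, e⟩ := h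
  refine ⟨N * X - M, fun h0 => ha ?_, ?_⟩
  · have := congrArg (fun p => p.coeff (d + 1 + 1)) h0
    simpa only [coeff_sub, coeff_mul_X, coeff_zero, sub_zero,
      coeff_eq_zero_of_natDegree_lt (show M.natDegree < d + 1 + 1 by omega)] using this
  · rw [map_sub, map_mul, aeval_X, ← e, mul_assoc, hxy, mul_one, sub_self]

end

/-- Complex functions of the parameter `t ∈ (0, 1/4)`. -/
abbrev ParamFun := Ioo (0 : ℝ) (1 / 4) → ℂ

/-- Complex functions of the parameter, as an algebra over the real polynomials in it. -/
instance paramFunAlgebra : Algebra (Polynomial ℝ) ParamFun :=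
  (Polynomial.aeval (fun t : Ioo (0 : ℝ) (1 / 4) => ((t : ℝ) : ℂ)) :
    Polynomial ℝ →ₐ[ℝ] ParamFun).toRingHom.toAlgebra

theorem algebraMap_paramFun_apply (p : Polynomial ℝ) (t : Ioo (0 : ℝ) (1 / 4)) :
    algebraMap (Polynomial ℝ) ParamFun p t = Polynomial.aeval ((t : ℝ) : ℂ) p := by
  change (Polynomial.aeval (fun t : Ioo (0 : ℝ) (1 / 4) => ((t : ℝ) : ℂ)) p : ParamFun) t = _
  exact (Polynomial.aeval_algHom_apply (Pi.evalAlgHom ℝ (fun _ : Ioo (0 : ℝ) (1 / 4) => ℂ) t)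
    (fun t : Ioo (0 : ℝ) (1 / 4) => ((t : ℝ) : ℂ)) p).symm

/-- Algebraicity over the real polynomials in the parameter. -/
abbrev IsAlgFun (f : ParamFun) : Prop := IsAlgebraic (Polynomial ℝ) f

theorem isAlgFun_param : IsAlgFun fun t => ((t : ℝ) : ℂ) := by
  convert isAlgebraic_algebraMap (R := Polynomial ℝ) (A := ParamFun) Polynomial.X using 1
  funext t
  rw [algebraMap_paramFun_apply, Polynomial.aeval_X]

theorem isAlgFun_ofReal (x : ℝ) : IsAlgFun fun _ => (x : ℂ) := by
  convert isAlgebraic_algebraMap (R := Polynomial ℝ) (A := ParamFun) (Polynomial.C x) using 1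
  funext t
  rw [algebraMap_paramFun_apply, Polynomial.aeval_C]
  rfl

theorem isAlgFun_const (c : ℂ) : IsAlgFun fun _ => c := by
  have hI : IsAlgFun fun _ => I := by
    refine IsAlgebraic.of_pow (n := 2) two_pos ?_
    convert isAlgFun_ofReal (-1) using 1
    funext t
    simp
  convert (isAlgFun_ofReal c.re).add ((isAlgFun_ofReal c.im).mul hI) using 1
  funext t
  exact (re_add_im c).symm

theorem IsAlgebraic.of_paramFun_mul_eq {f g h : ParamFun} (hf : IsAlgFun f) (hh : IsAlgFun h)
    (hf0 : ∀ t, f t ≠ 0) (e : ∀ t, f t * g t = h t) : IsAlgFun g := by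
  refine IsAlgebraic.of_mul (y := f) ?_ hf ?_
  · rw [mem_nonZeroDivisors_iff_right]
    intro z hz
    funext t
    exact (mul_eq_zero.1 (congrFun hz t)).resolve_right (hf0 t)
  · rwa [show f * g = h from funext e]

theorem isAlgFun_inv_two_mul : IsAlgFun fun t => (2 * ((t : ℝ) : ℂ))⁻¹ := by
  have h (t : Ioo (0 : ℝ) (1 / 4)) : 2 * ((t : ℝ) : ℂ) ≠ 0 :=
    mul_ne_zero two_ne_zero (by exact_mod_cast t.2.1.ne')
  exact ((isAlgFun_const 2).mul isAlgFun_param).of_paramFun_mul_eq (isAlgFun_const 1) h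
    fun t => mul_inv_cancel₀ (h t)

theorem isAlgFun_sectionModulus : IsAlgFun fun t => sectionModulus t :=
  (isAlgFun_inv_two_mul.pow 2).sub (isAlgFun_const 4)

section

variable {k g : Ioo (0 : ℝ) (1 / 4) → ℂ → ℂ} (h : ∀ t : Ioo (0 : ℝ) (1 / 4),
  SectionRelations t (k t) (g t)) {s : ℂ}

include h

theorem hasLinearGrowth_oppRatio_sq (hs : IsGenericUnit s) (hs2 : IsGenericUnit (s * s)) :
    HasLinearGrowth (R := Polynomial ℝ) (S := ParamFun) (fun t => oppRatio (g t) s)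
      (fun t => oppRatio (g t) (s * s)) 4 := by
  refine HasLinearGrowth.of_doubling (p := 1 - 16 * Polynomial.X ^ 2)
    (q := 1 + 16 * Polynomial.X ^ 2) (fun h0 => ?_) ?_
  · have := congrArg (Polynomial.eval 0) h0
    simp at this
  · funext t
    simp only [Pi.mul_apply, Pi.add_apply, Pi.sub_apply, Pi.pow_apply, 
      Pi.ofNat_apply, algebraMap_paramFun_apply, map_sub, map_add, map_mul, map_pow, map_one,
      map_ofNat, Polynomial.aeval_X]
    have h1 := (h t).doubling t.2 hs hs2
    have h2 := (h t).oddDiff_sq t.2 hs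
    have ht0 : ((t : ℝ) : ℂ) ≠ 0 := by exact_mod_cast t.2.1.ne'
    have h3 : 1 - 16 * ((t : ℝ) : ℂ) ^ 2 = 4 * ((t : ℝ) : ℂ) ^ 2 * sectionModulus t := by
      rw [sectionModulus]
      field_simp
      ring
    have h4 : 1 + 16 * ((t : ℝ) : ℂ) ^ 2 = 4 * ((t : ℝ) : ℂ) ^ 2 * (sectionModulus t + 8) := by
      rw [sectionModulus]
      field_simp
      ring
    rw [h3, h4]
    linear_combination 4 * ((t : ℝ) : ℂ) ^ 2 * h1 + 16 * ((t : ℝ) : ℂ) ^ 2 *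
      oppRatio (g t) s * oppRatio (g t) (s * s) * h2

theorem isAlgFun_oddDiff {u : ℂ} (hu : IsGenericUnit u) (hr : IsAlgFun fun t => oppRatio (g t) u) :
    IsAlgFun fun t => oddDiff (k t) u := by
  refine IsAlgebraic.of_pow (n := 2) two_pos ?_
  have hγ := isAlgFun_sectionModulus
  exact hr.of_paramFun_mul_eq (((hγ.mul ((hr.pow 2).add (isAlgFun_const 1))).neg).sub
    (((isAlgFun_const 2).mul (hγ.add (isAlgFun_const 8))).mul hr))
    (fun t => (h t).oppRatio_ne_zero t.2 hu) fun t => (h t).oddDiff_sq t.2 hu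

theorem isAlgFun_apply_mul_sub {u v : ℂ} (hu : IsGenericUnit u) (hv : IsGenericUnit v)
    (huv : IsGenericUnit (u * v)) (h1 : ∀ t, oppRatio (g t) u * oppRatio (g t) v ≠ 1)
    (hru : IsAlgFun fun t => oppRatio (g t) u) (hrv : IsAlgFun fun t => oppRatio (g t) v)
    (hruv : IsAlgFun fun t => oppRatio (g t) (u * v)) :
    IsAlgFun fun t => k t (u * v) - k t u - k t v := by
  have hd := (isAlgFun_oddDiff h hu hru).add (isAlgFun_oddDiff h hv hrv)
  have h2 : IsAlgFun fun t => k t u + k t v - k t (-(u * v)) :=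
    ((hru.mul hrv).sub (isAlgFun_const 1)).of_paramFun_mul_eq (hd.mul (hru.mul hrv))
      (fun t => sub_ne_zero.2 (h1 t))
      fun t => (mul_comm _ _).trans ((h t).apply_eq_sub t.2 hu hv huv)
  convert (isAlgFun_oddDiff h huv hruv).sub h2 using 1
  funext t
  simp only [Pi.sub_apply, oddDiff]
  ring

variable {n : ℕ} (hn : 3 ≤ n) (hs : ∀ m, 1 ≤ m → m < n → IsGenericUnit (s ^ m))

include hn hs

omit h in
theorem isGenericUnit_self : IsGenericUnit s := by simpa using hs 1 le_rfl (by omega)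

omit h in
theorem isGenericUnit_mul_self : IsGenericUnit (s * s) := by
  simpa [pow_two] using hs 2 (by omega) (by omega)

omit h in
theorem pow_succ_mul_inv (m : ℕ) : s ^ (m + 1) * s⁻¹ = s ^ m := by
  rw [pow_succ, mul_assoc, mul_inv_cancel₀ (isGenericUnit_self hn hs).ne_zero, mul_one]

theorem hasLinearGrowth_oppRatio_pow (m : ℕ) (hm : m + 2 < n) :
    HasLinearGrowth (R := Polynomial ℝ) (S := ParamFun) (fun t => oppRatio (g t) s)
      (fun t => oppRatio (g t) (s ^ (m + 1))) ((m + 1) ^ 2) ∧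
    HasLinearGrowth (R := Polynomial ℝ) (S := ParamFun) (fun t => oppRatio (g t) s)
      (fun t => oppRatio (g t) (s ^ (m + 2))) ((m + 2) ^ 2) := by
  have hs1 := isGenericUnit_self hn hs
  have hs2 := isGenericUnit_mul_self hn hs
  induction m with
  | zero =>
    constructor
    · simpa using hasLinearGrowth_self (R := Polynomial ℝ) (S := ParamFun) _
    · convert hasLinearGrowth_oppRatio_sq h hs1 hs2 using 1
      · simp [pow_two]
      · norm_num
  | succ m ih =>
    obtain ⟨h1, h2⟩ := ih (by omega)
    refine ⟨?_, ?_⟩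
    · convert h2 using 1
      push_cast
      ring
    · refine HasLinearGrowth.step h2 h1 ?_ ?_ ?_
      · exact pow_ne_zero 2 (by exact_mod_cast m.succ_ne_zero)
      · push_cast
        ring
      · funext t
        have e : s ^ (m + 2) * s⁻¹ = s ^ (m + 1) := pow_succ_mul_inv hn hs _
        have := (h t).oppRatio_mul_mul_div t.2 (hs (m + 2) (by omega) (by omega)) hs1
          (by rw [← pow_succ]; exact hs _ (by omega) hm)
          (by rw [e]; exact hs _ (by omega) (by omega)) hs2
        rw [e, ← pow_succ] at this
        exact this

variable (hsn : s ^ n = 1 ∨ s ^ n = -1)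

include hsn

theorem isAlgFun_oppRatio : IsAlgFun fun t => oppRatio (g t) s := by
  obtain ⟨m, rfl⟩ := Nat.exists_eq_add_of_le' hn
  have hs1 := isGenericUnit_self hn hs
  have h2 := (hasLinearGrowth_oppRatio_pow h hn hs m (by omega)).2
  rw [pow_succ] at hsn
  rcases hsn with e | e
  · have e' : s ^ (m + 2) = s⁻¹ := eq_inv_of_mul_eq_one_left e
    have e2 : (fun t => oppRatio (g t) (s ^ (m + 2))) = fun t => oppRatio (g t) s := by
      funext t
      rw [e', (h t).oppRatio_inv t.2 hs1]
    rw [e2] at h2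
    refine h2.isAlgebraic_of_self fun h0 => ?_
    have h3 := congrArg (Polynomial.eval 0) h0
    simp only [Polynomial.eval_pow, Polynomial.eval_add, Polynomial.eval_natCast,
      Polynomial.eval_ofNat, Polynomial.eval_one] at h3
    nlinarith [(Nat.cast_nonneg m : (0 : ℝ) ≤ m)]
  · have e' : s ^ (m + 2) = -s⁻¹ := by
      rw [← inv_neg]
      refine eq_inv_of_mul_eq_one_left ?_
      rw [mul_neg, e, neg_neg]
    refine h2.isAlgebraic_of_mul_eq_one ?_
    funext t
    simp only [Pi.mul_apply, Pi.one_apply]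
    rw [e', SectionRelations.oppRatio_neg, (h t).oppRatio_inv t.2 hs1]
    exact inv_mul_cancel₀ ((h t).oppRatio_ne_zero t.2 hs1)

theorem isAlgFun_oppRatio_pow (m : ℕ) (hm : m + 2 < n) :
    IsAlgFun (fun t => oppRatio (g t) (s ^ (m + 1))) ∧
    IsAlgFun (fun t => oppRatio (g t) (s ^ (m + 2))) := by
  have hs1 := isGenericUnit_self hn hs
  have hs2 := isGenericUnit_mul_self hn hs
  have hr := isAlgFun_oppRatio h hn hs hsn
  induction m with
  | zero =>
    constructor
    · simpa using hr
    · have hd := isAlgFun_oddDiff h hs1 hr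
      simp only [zero_add, pow_two s]
      exact (((isAlgFun_const (-4)).mul (hd.pow 2)).mul (hr.pow 2)).of_paramFun_mul_eq
        (isAlgFun_sectionModulus.mul (((hr.pow 2).sub (isAlgFun_const 1)).pow 2))
        (fun t => mul_ne_zero (mul_ne_zero (by norm_num)
          (pow_ne_zero 2 ((h t).oddDiff_ne_zero t.2 hs1 hs2)))
          (pow_ne_zero 2 ((h t).oppRatio_ne_zero t.2 hs1)))
        fun t => (h t).doubling t.2 hs1 hs2
  | succ m ih =>
    obtain ⟨h1, h2⟩ := ih (by omega)
    refine ⟨h2, ?_⟩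
    have e : s ^ (m + 2) * s⁻¹ = s ^ (m + 1) := pow_succ_mul_inv hn hs _
    have g1 := hs (m + 1) (by omega) (by omega)
    have g2 := hs (m + 2) (by omega) (by omega)
    have g3 : IsGenericUnit (s ^ (m + 2) * s) := by
      rw [← pow_succ]
      exact hs _ (by omega) hm
    have g4 : IsGenericUnit (s ^ (m + 2) * s⁻¹) := by rwa [e]
    refine (h1.mul ((h2.sub hr).pow 2)).of_paramFun_mul_eq (((h2.mul hr).sub
        (isAlgFun_const 1)).pow 2)
      (fun t => mul_ne_zero ((h t).oppRatio_ne_zero t.2 g1) (pow_ne_zero 2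
        (sub_ne_zero.2 ((h t).oppRatio_ne t.2 g2 hs1 g3 g4 hs2)))) fun t => ?_
    have := (h t).oppRatio_mul_mul_div t.2 g2 hs1 g3 g4 hs2
    rw [e, ← pow_succ] at this
    simp only [Pi.mul_apply, Pi.sub_apply, Pi.pow_apply]
    linear_combination this

theorem isAlgFun_apply_pow_sub (m : ℕ) (hm : m + 1 < n) :
    IsAlgFun fun t => k t (s ^ (m + 1)) - (m + 1) * k t s := by
  have hs1 := isGenericUnit_self hn hs
  have hs2 := isGenericUnit_mul_self hn hs
  have hr := isAlgFun_oppRatio h hn hs hsn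
  induction m with
  | zero => simpa using isAlgFun_const 0
  | succ m ih =>
    obtain ⟨h1, h2⟩ := isAlgFun_oppRatio_pow h hn hs hsn m (by omega)
    have g1 := hs (m + 1) (by omega) (by omega)
    have g3 : IsGenericUnit (s ^ (m + 1) * s) := by
      rw [← pow_succ]
      exact hs _ (by omega) hm
    have hne : ∀ t, oppRatio (g t) (s ^ (m + 1)) * oppRatio (g t) s ≠ 1 := by
      intro t
      rcases m with _ | m
      · rw [zero_add, pow_one, ← pow_two]
        exact (h t).oppRatio_sq_ne_one t.2 hs1 hs2
      · refine (h t).oppRatio_mul_ne_one t.2 g1 hs1 g3 ?_ hs2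
        rw [pow_succ_mul_inv hn hs]
        exact hs _ (by omega) (by omega)
    have h3 := isAlgFun_apply_mul_sub h g1 hs1 g3 hne h1 hr (by rw [← pow_succ]; exact h2)
    convert h3.add (ih (by omega)) using 1
    funext t
    simp only [Pi.add_apply, ← pow_succ]
    push_cast
    ring

theorem isAlgFun_apply : IsAlgFun fun t => k t s := by
  have hs1 := isGenericUnit_self hn hs
  have hr := isAlgFun_oppRatio h hn hs hsn
  obtain ⟨m, rfl⟩ := Nat.exists_eq_add_of_le' hn
  have h1 := isAlgFun_apply_pow_sub h hn hs hsn (m + 1) (by omega)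
  have hne : ((m + 3 : ℕ) : ℂ) ≠ 0 := by exact_mod_cast (m + 2).succ_ne_zero
  rw [pow_succ] at hsn
  rcases hsn with e | e
  · have e' : s ^ (m + 1 + 1) = s⁻¹ := eq_inv_of_mul_eq_one_left e
    refine (isAlgFun_const (m + 3 : ℕ)).of_paramFun_mul_eq h1.neg (fun _ => hne) fun t => ?_
    simp only [Pi.neg_apply, e', (h t).inv s hs1.norm_eq hs1.ne_one]
    push_cast
    ring
  · have e' : s ^ (m + 1 + 1) = (-s)⁻¹ := by
      refine eq_inv_of_mul_eq_one_left ?_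
      rw [mul_neg, e, neg_neg]
    refine (isAlgFun_const (m + 3 : ℕ)).of_paramFun_mul_eq ((isAlgFun_oddDiff h hs1 hr).sub h1)
      (fun _ => hne) fun t => ?_
    simp only [Pi.sub_apply, e', (h t).inv (-s) hs1.neg.norm_eq hs1.neg.ne_one, oddDiff]
    push_cast
    ring

end

theorem quarterPhase_pow (b : ℝ) (n : ℕ) :
    quarterPhase b ^ n = cexp ((n * b / 4 : ℝ) * -(2 * π * I)) := by
  rw [quarterPhase, ← Complex.exp_nat_mul]
  congr 1
  push_cast
  ring

theorem quarterPhase_pow_eq_one_iff (b : ℝ) (n : ℕ) :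
    quarterPhase b ^ n = 1 ↔ ∃ m : ℤ, n * b = 4 * m := by
  rw [quarterPhase_pow, mul_neg, Complex.exp_neg, inv_eq_one, Complex.exp_eq_one_iff]
  refine exists_congr fun m => ?_
  rw [mul_left_inj' (by simp [Real.pi_ne_zero])]
  constructor
  · intro h
    have : (n * b / 4 : ℝ) = m := by exact_mod_cast h
    linarith
  · intro h
    have : (n * b / 4 : ℝ) = m := by linarith
    exact_mod_cast this

theorem isAlgFun_Fchar (b : ℚ) (hb : ∀ n : ℤ, b ≠ (n : ℚ)) : IsAlgFun fun t => Fchar t b := by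
  set s := quarterPhase b with hs
  have s0 : s ≠ 0 := norm_pos_iff.1 (by rw [hs, norm_quarterPhase]; exact one_pos)
  have h4 : s ^ 4 ≠ 1 := by
    rw [hs, Ne, quarterPhase_pow_eq_one_iff]
    rintro ⟨m, hm⟩
    refine hb m ?_
    have : (b : ℝ) = m := by push_cast at hm; linarith
    exact_mod_cast this
  have h2 : s ^ 2 ≠ 1 := fun h => h4 (by rw [show 4 = 2 * 2 from rfl, pow_mul, h, one_pow])
  have h1 : s ≠ 1 := fun h => h2 (by rw [h, one_pow])
  have hfin : IsOfFinOrder (s ^ 2) := by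
    rw [isOfFinOrder_iff_pow_eq_one]
    refine ⟨2 * b.den, by have := b.den_pos; omega, ?_⟩
    rw [← pow_mul, hs, quarterPhase_pow_eq_one_iff]
    refine ⟨b.num, ?_⟩
    have := b.den_mul_eq_num
    have : (b.den : ℝ) * b = b.num := by exact_mod_cast this
    push_cast
    linear_combination 4 * this
  have hpos := hfin.orderOf_pos
  have hn1 : orderOf (s ^ 2) ≠ 1 := fun h => h2 (orderOf_eq_one_iff.1 h)
  have hn2 : orderOf (s ^ 2) ≠ 2 := fun h => h4 (by
    have := pow_orderOf_eq_one (s ^ 2)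
    rwa [h, ← pow_mul] at this)
  have hn : 3 ≤ orderOf (s ^ 2) := by omega
  have hgen (m : ℕ) (hm : 1 ≤ m) (hmn : m < orderOf (s ^ 2)) : IsGenericUnit (s ^ m) := by
    refine .of_sq_ne_one (by rw [norm_pow, hs, norm_quarterPhase, one_pow]) ?_
    rw [← pow_mul, mul_comm, pow_mul]
    exact pow_ne_one_of_lt_orderOf (by omega) hmn
  have hsn : s ^ orderOf (s ^ 2) = 1 ∨ s ^ orderOf (s ^ 2) = -1 := by
    refine sq_eq_one_iff.1 ?_
    rw [← pow_mul, mul_comm, pow_mul, pow_orderOf_eq_one]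
  choose k g hkg hF using fun t : Ioo (0 : ℝ) (1 / 4) => exists_sectionRelations_Fchar t.2
  have hk := isAlgFun_apply hkg hn hgen hsn
  have hν : (1 + s⁻¹) * (s + s⁻¹) ≠ 0 := by
    intro h
    refine h4 ?_
    field_simp at h
    have : (s + 1) * (s ^ 2 + 1) = 0 := by simpa using h
    linear_combination (s - 1) * this
  refine (isAlgFun_const ((1 + s⁻¹) * (s + s⁻¹))).of_paramFun_mul_eq
    (((isAlgFun_const 4).mul isAlgFun_param).mul
      (((hk.sub isAlgFun_inv_two_mul).mul (isAlgFun_const (1 - s⁻¹))).add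
        ((isAlgFun_const 2).mul isAlgFun_inv_two_mul))) (fun _ => hν) fun t => ?_
  have := hF t b s rfl h1
  refine this.trans ?_
  simp only [Pi.mul_apply, Pi.add_apply, Pi.sub_apply]
  rw [mul_inv]
  ring

/-- Algebraicity over the polynomials in the parameter gives a polynomial relation in two
variables. -/
theorem exists_mvPolynomial_of_isAlgFun {f : ParamFun} (hf : IsAlgFun f) :
    ∃ P : MvPolynomial (Fin 2) ℝ, P ≠ 0 ∧ ∀ t : Ioo (0 : ℝ) (1 / 4),
      MvPolynomial.aeval (fun i : Fin 2 => if i = 0 then ((t : ℝ) : ℂ) else f t) P = 0 := by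
  obtain ⟨p, hp, hpf⟩ := hf
  set ψ : Polynomial (Polynomial ℝ) →+* MvPolynomial (Fin 2) ℝ :=
    Polynomial.eval₂RingHom (Polynomial.aeval (MvPolynomial.X 0)).toRingHom (MvPolynomial.X 1)
    with hψ
  have hinj : Function.Injective ψ := by
    refine Function.LeftInverse.injective
      (g := MvPolynomial.eval₂Hom (Polynomial.C.comp Polynomial.C)
        ![Polynomial.C Polynomial.X, Polynomial.X]) fun q => ?_
    rw [← RingHom.comp_apply]
    conv_rhs => rw [← RingHom.id_apply q]
    congr 1
    ext <;> simp [hψ]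
  refine ⟨ψ p, fun h => hp (hinj (h.trans (map_zero ψ).symm)), fun t => ?_⟩
  have h1 : (MvPolynomial.aeval (fun i : Fin 2 => if i = 0 then ((t : ℝ) : ℂ) else f t) :
        MvPolynomial (Fin 2) ℝ →ₐ[ℝ] ℂ).toRingHom.comp ψ =
      (Pi.evalRingHom (fun _ : Ioo (0 : ℝ) (1 / 4) => ℂ) t).comp
        (Polynomial.aeval f : Polynomial (Polynomial ℝ) →ₐ[Polynomial ℝ] ParamFun).toRingHom := by
    ext <;> simp [hψ, algebraMap_paramFun_apply]
  have h2 := congrArg (fun φ => φ p) h1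
  simp only [RingHom.comp_apply] at h2
  refine h2.trans ?_
  change (Polynomial.aeval f p : ParamFun) t = 0
  rw [hpf]
  rfl

/-- Corollary 13 (algebraicity): for every `b ∈ ℚ∖ℤ` there is a nonzero two-variable real
polynomial `P` with `P(t, F(t,b)) = 0` for all `t ∈ (0,1/4)`. -/
theorem statement11 (b : ℚ) (hb : ∀ n : ℤ, b ≠ (n : ℚ)) :
    ∃ P : MvPolynomial (Fin 2) ℝ, P ≠ 0 ∧
      ∀ t ∈ Set.Ioo (0 : ℝ) (1 / 4),
        MvPolynomial.aeval
          (fun i : Fin 2 => if i = 0 then (t : ℂ) else Fchar t (b : ℝ)) P = 0 := by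
  obtain ⟨P, hP, h⟩ := exists_mvPolynomial_of_isAlgFun (isAlgFun_Fchar b hb)
  exact ⟨P, hP, fun t ht => h ⟨t, ht⟩⟩

end
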